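/- arXiv:2005.09990 — 3 statements merged into one kernel-verified Lean document; each statement's English description precedes it below -/
import Mathlib

section
/- There exists an absolute constant C > 0 with the following property. Let q be a prime power, n, k, r positive integers, and let w ∈ F_k be a nontrivial word of reduced length ℓ with ℓ·r² < n/4 which is not a proper power (i.e., w ≠ u^m for every u ∈ F_k and every integer m ≥ 2). Let v_1, …, v_r be linearly independent vectors in F_q^n, and set N = ∏_{i=0}^{r−1} (q^n − q^i). Choose x_1, …, x_k independently and uniformly at random from GL_n(q). Then the probability that w(x_1, …, x_k)·v_i = v_i for every i = 1, …, r is at most (1/N) · (1 + C·q^{2ℓr − n/2}). -/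
open Module

section Leads

variable {F I O : Type*} [Field F] [Fintype I] [LinearOrder O]

open Classical in
/-- The indices at which some vector of `K` has its last nonzero coordinate, where coordinates are
ordered by `rk`. -/
noncomputable def leads (rk : I → O) (K : Submodule F (I → F)) : Finset I :=
  {s | ∃ u ∈ K, u s ≠ 0 ∧ ∀ t, rk s < rk t → u t = 0}

theorem mem_leads {rk : I → O} {K : Submodule F (I → F)} {s : I} :
    s ∈ leads rk K ↔ ∃ u ∈ K, u s ≠ 0 ∧ ∀ t, rk s < rk t → u t = 0 := by
  simp [leads]

theorem exists_last_ne_zero (rk : I → O) {u : I → F} (hu : u ≠ 0) :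
    ∃ s, u s ≠ 0 ∧ ∀ t, rk s < rk t → u t = 0 := by
  classical
  obtain ⟨i, hi⟩ := Function.ne_iff.mp hu
  obtain ⟨s, hs, hmax⟩ := Finset.exists_max_image {s : I | u s ≠ 0} rk ⟨i, by simpa using hi⟩
  refine ⟨s, by simpa using hs, fun t ht => ?_⟩
  by_contra h
  exact absurd (hmax t (by simpa using h)) (not_le.mpr ht)

theorem card_leads {rk : I → O} (hrk : Function.Injective rk) (K : Submodule F (I → F)) :
    (leads rk K).card = finrank F K := by
  classical
  apply le_antisymm
  · choose κ hκ using fun s : leads rk K => mem_leads.mp s.2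
    have hli : LinearIndependent F (fun s => (⟨κ s, (hκ s).1⟩ : K)) := by
      rw [Fintype.linearIndependent_iff]
      intro c hc
      by_contra hne
      push Not at hne
      obtain ⟨s, hs, hmax⟩ := exists_last_ne_zero (fun s : leads rk K => rk s)
        (u := c) (by rintro rfl; simp at hne)
      have h := congrArg (fun u : K => (u : I → F) s) hc
      simp only [Submodule.coe_sum, Submodule.coe_smul, Finset.sum_apply, Pi.smul_apply,
        smul_eq_mul, Submodule.coe_zero, Pi.zero_apply] at h
      rw [Finset.sum_eq_single s] at h
      · exact (mul_ne_zero hs (hκ s).2.1) h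
      · intro t _ hts
        rcases lt_trichotomy (rk t) (rk s) with hlt | heq | hgt
        · rw [(hκ t).2.2 _ hlt, mul_zero]
        · exact absurd (Subtype.ext (hrk heq)) hts
        · rw [hmax t hgt, zero_mul]
      · simp
    simpa using hli.fintype_card_le_finrank
  · let f : K →ₗ[F] (leads rk K → F) := LinearMap.funLeft F F Subtype.val ∘ₗ K.subtype
    have hf : Function.Injective f := by
      rw [injective_iff_map_eq_zero]
      intro u hu
      by_contra hne
      obtain ⟨s, hs, hmax⟩ := exists_last_ne_zero rk (u := (u : I → F)) (by simpa using hne)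
      exact hs (congrFun hu ⟨s, mem_leads.mpr ⟨u, u.2, hs, hmax⟩⟩)
    simpa using LinearMap.finrank_le_finrank_of_injective hf

end Leads

section Push

variable {F A I : Type*} [Field F] [Fintype A] [DecidableEq I]

/-- The linear map sending the coordinate vector of `a` to that of `f a`. -/
def push (f : A → I) : (A → F) →ₗ[F] (I → F) where
  toFun u v := ∑ a, if f a = v then u a else 0
  map_add' u v := by
    ext i
    simp only [Pi.add_apply, ← Finset.sum_add_distrib]
    exact Finset.sum_congr rfl fun a _ => by split <;> simp
  map_smul' c u := by
    ext i
    simp only [Pi.smul_apply, smul_eq_mul, Finset.mul_sum, RingHom.id_apply]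
    exact Finset.sum_congr rfl fun a _ => by split <;> simp

theorem push_apply (f : A → I) (u : A → F) (v : I) :
    push f u v = ∑ a, if f a = v then u a else 0 := rfl

theorem exists_of_push_ne_zero {f : A → I} {u : A → F} {v : I} (h : push f u v ≠ 0) :
    ∃ a, f a = v ∧ u a ≠ 0 := by
  contrapose! h
  exact Finset.sum_eq_zero fun a _ => by
    split_ifs with hf
    exacts [h a hf, rfl]

theorem push_apply_eq {f : A → I} {u : A → F} {a : A}
    (h : ∀ b, f b = f a → u b ≠ 0 → b = a) : push f u (f a) = u a := by
  rw [push_apply, Finset.sum_eq_single a]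
  · simp
  · intro b _ hba
    split_ifs with hf
    · by_contra hb
      exact hba (h b hf hb)
    · rfl
  · simp

end Push

section Cycles

theorem Fin.val_add_one_of_ne_zero {ℓ : ℕ} [NeZero ℓ] {d : Fin ℓ} (h : d + 1 ≠ 0) :
    (d + 1).val = d.val + 1 := by
  obtain ⟨m, rfl⟩ := Nat.exists_eq_succ_of_ne_zero (NeZero.ne ℓ)
  rw [Fin.val_add_one]
  split_ifs with hd
  · subst hd
    simp at h
  · rfl

/-- The lexicographic rank of a vertex when each cycle is cut open at `b`. -/
def cutRank {ℓ r : ℕ} (b : Fin ℓ) (p : Fin r × Fin ℓ) : Fin r ×ₗ Fin ℓ :=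
  toLex (p.1, p.2 - b)

theorem cutRank_lt {ℓ r : ℕ} {b : Fin ℓ} {p p' : Fin r × Fin ℓ} :
    cutRank b p < cutRank b p' ↔ p.1 < p'.1 ∨ p.1 = p'.1 ∧ p.2 - b < p'.2 - b :=
  Prod.Lex.toLex_lt_toLex

theorem cutRank_le {ℓ r : ℕ} {b : Fin ℓ} {p p' : Fin r × Fin ℓ} :
    cutRank b p ≤ cutRank b p' ↔ p.1 < p'.1 ∨ p.1 = p'.1 ∧ p.2 - b ≤ p'.2 - b :=
  Prod.Lex.toLex_le_toLex

variable {ℓ r : ℕ} [NeZero ℓ] {ι : Type*} (g : Fin ℓ → ι × Bool)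

/-- The edge `e` of a cycle of length `ℓ` labelled by letters joins `e` and `e + 1`; its endpoint on
the side `β` is `e + 1` if its letter has sign `β`, and `e` otherwise. We take `r` copies. -/
def endpoint (β : Bool) (e : Fin r × Fin ℓ) : Fin r × Fin ℓ :=
  (e.1, if (g e.2).2 = β then e.2 + 1 else e.2)

/-- No letter is cyclically followed by its inverse. -/
def CyclicallyReduced : Prop :=
  ∀ e, (g e).1 = (g (e + 1)).1 → (g e).2 = (g (e + 1)).2

/-- The cyclic sequence `g` has no nontrivial rotational symmetry. -/
def Aperiodic : Prop :=
  ∀ t, (∀ b, g (b + t) = g b) → t = 0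

theorem cutRank_injective (b : Fin ℓ) : Function.Injective (cutRank (r := r) b) := by
  rintro ⟨i, s⟩ ⟨i', s'⟩ h
  simpa [cutRank] using h

theorem sub_val_succ {b s : Fin ℓ} (h : s + 1 ≠ b) : (s + 1 - b).val = (s - b).val + 1 := by
  have : s + 1 - b = (s - b) + 1 := by abel
  rw [this]
  apply Fin.val_add_one_of_ne_zero
  rw [← this]
  exact sub_ne_zero.mpr h

theorem cutRank_lt_succ {b : Fin ℓ} {p : Fin r × Fin ℓ} (h : p.2 + 1 ≠ b) :
    cutRank b p < cutRank b (p.1, p.2 + 1) := by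
  rw [cutRank_lt]
  refine Or.inr ⟨rfl, ?_⟩
  rw [Fin.lt_def, sub_val_succ h]
  omega

theorem cutRank_succ_le {b : Fin ℓ} {p p' : Fin r × Fin ℓ} (h : cutRank b p < cutRank b p') :
    cutRank b (p.1, p.2 + 1) ≤ cutRank b p' := by
  rw [cutRank_lt] at h
  rw [cutRank_le]
  refine h.imp id fun ⟨h1, h2⟩ => ⟨h1, ?_⟩
  by_cases hb : p.2 + 1 = b
  · simp [hb]
  · rw [Fin.le_def, sub_val_succ hb]
    exact h2

theorem endpoint_cutRank_le {b : Fin ℓ} {β : Bool} {p p' : Fin r × Fin ℓ}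
    (h : cutRank b p < cutRank b p') : cutRank b (endpoint g β p) ≤ cutRank b p' := by
  unfold endpoint
  split_ifs
  · exact cutRank_succ_le h
  · exact h.le

theorem endpoint_self (e : Fin r × Fin ℓ) : endpoint g (g e.2).2 e = (e.1, e.2 + 1) := by
  simp [endpoint]

theorem endpoint_not_self (e : Fin r × Fin ℓ) : endpoint g (!(g e.2).2) e = e := by
  simp [endpoint]

variable {g}

theorem endpoint_injOn (hg : CyclicallyReduced g) {β : Bool} {e f : Fin r × Fin ℓ}
    (hl : (g e.2).1 = (g f.2).1) (h : endpoint g β e = endpoint g β f) : e = f := by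
  obtain ⟨i, e⟩ := e
  obtain ⟨i', f⟩ := f
  simp only [endpoint, Prod.mk.injEq] at h hl ⊢
  refine ⟨h.1, ?_⟩
  have h2 := h.2
  split_ifs at h2 with h3 h4 h4
  · exact add_right_cancel h2
  · subst h2
    exact absurd ((hg e hl).symm.trans h3) h4
  · subst h2
    exact absurd ((hg f hl.symm).symm.trans h4) h3
  · exact h2

section Spaces

variable {F : Type*} [Field F] {b : Fin ℓ} {e : Fin r × Fin ℓ} {u : Fin r × Fin ℓ → F}

theorem push_endpoint_apply (hg : CyclicallyReduced g) {β : Bool} {j : ι}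
    (hu : ∀ f, u f ≠ 0 → (g f.2).1 = j) (he : (g e.2).1 = j) :
    push (endpoint g β) u (endpoint g β e) = u e :=
  push_apply_eq fun f hf huf => endpoint_injOn hg ((hu f huf).trans he.symm) hf

theorem push_endpoint_not_self_eq_zero (h : ∀ t, cutRank b e < cutRank b t → u t = 0)
    {t : Fin r × Fin ℓ} (ht : cutRank b e < cutRank b t) :
    push (endpoint g (!(g e.2).2)) u t = 0 := by
  by_contra hne
  obtain ⟨f, rfl, hf⟩ := exists_of_push_ne_zero hne
  rcases lt_trichotomy (cutRank b f) (cutRank b e) with hlt | heq | hgt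
  · exact absurd (endpoint_cutRank_le g hlt) (not_le.mpr ht)
  · rw [cutRank_injective b heq, endpoint_not_self] at ht
    exact lt_irrefl _ ht
  · exact hf (h f hgt)

theorem push_endpoint_self_eq_zero (h : ∀ t, cutRank b e < cutRank b t → u t = 0)
    (hb : e.2 + 1 ≠ b) {t : Fin r × Fin ℓ} (ht : cutRank b (e.1, e.2 + 1) < cutRank b t) :
    push (endpoint g (g e.2).2) u t = 0 := by
  by_contra hne
  obtain ⟨f, rfl, hf⟩ := exists_of_push_ne_zero hne
  rcases lt_trichotomy (cutRank b f) (cutRank b e) with hlt | heq | hgt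
  · exact absurd ((endpoint_cutRank_le g hlt).trans_lt (cutRank_lt_succ hb)) ht.not_gt
  · rw [cutRank_injective b heq, endpoint_self] at ht
    exact lt_irrefl _ ht
  · exact hf (h f hgt)

variable (g) in
/-- The vectors supported on the edges with label `j` whose two boundaries lie in `K`. -/
def edgeSpace (K : Submodule F (Fin r × Fin ℓ → F)) (j : ι) :
    Submodule F (Fin r × Fin ℓ → F) where
  carrier := {u | (∀ e, (g e.2).1 ≠ j → u e = 0) ∧ ∀ β, push (endpoint g β) u ∈ K}
  add_mem' := fun hu hv => ⟨fun e he => by simp [hu.1 e he, hv.1 e he],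
    fun β => by rw [map_add]; exact K.add_mem (hu.2 β) (hv.2 β)⟩
  zero_mem' := by simp
  smul_mem' := fun c u hu => ⟨fun e he => by simp [hu.1 e he],
    fun β => by rw [map_smul]; exact K.smul_mem c (hu.2 β)⟩

theorem label_of_mem_edgeSpace {K : Submodule F (Fin r × Fin ℓ → F)} {j : ι}
    (hu : u ∈ edgeSpace g K j) (e : Fin r × Fin ℓ) (he : u e ≠ 0) : (g e.2).1 = j := by
  by_contra h
  exact he (hu.1 e h)

variable (g) in
open Classical in
/-- The leading edges of all the spaces `edgeSpace g K j`. -/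
noncomputable def edgeLeads (b : Fin ℓ) (K : Submodule F (Fin r × Fin ℓ → F)) :
    Finset (Fin r × Fin ℓ) :=
  {e | e ∈ leads (cutRank b) (edgeSpace g K (g e.2).1)}

theorem mem_edgeLeads {K : Submodule F (Fin r × Fin ℓ → F)} :
    e ∈ edgeLeads g b K ↔ ∃ u ∈ edgeSpace g K (g e.2).1, u e ≠ 0 ∧
      ∀ t, cutRank b e < cutRank b t → u t = 0 := by
  simp [edgeLeads, mem_leads]

theorem card_edgeLeads [Fintype ι] (K : Submodule F (Fin r × Fin ℓ → F)) :
    (edgeLeads g b K).card = ∑ j, finrank F (edgeSpace g K j) := by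
  classical
  rw [Finset.card_eq_sum_card_fiberwise (f := fun e => (g e.2).1) (t := Finset.univ) (by simp)]
  refine Finset.sum_congr rfl fun j _ => ?_
  rw [← card_leads (cutRank_injective b)]
  congr 1
  ext e
  simp only [Finset.mem_filter, mem_edgeLeads]
  constructor
  · rintro ⟨h, rfl⟩
    exact mem_leads.mpr h
  · intro h
    obtain ⟨u, hu, hne, htop⟩ := mem_leads.mp h
    obtain rfl := label_of_mem_edgeSpace hu e hne
    exact ⟨⟨u, hu, hne, htop⟩, rfl⟩

theorem edgeLeads_subset_leads (hg : CyclicallyReduced g) (b : Fin ℓ)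
    (K : Submodule F (Fin r × Fin ℓ → F)) : edgeLeads g b K ⊆ leads (cutRank b) K := by
  intro e he
  obtain ⟨u, hu, hne, htop⟩ := mem_edgeLeads.mp he
  refine mem_leads.mpr ⟨_, hu.2 (!(g e.2).2), ?_, fun t => push_endpoint_not_self_eq_zero htop⟩
  have := push_endpoint_apply hg (β := !(g e.2).2) (label_of_mem_edgeSpace hu) rfl
  rw [endpoint_not_self] at this
  rwa [this]

theorem succ_mem_leads (hg : CyclicallyReduced g) {K : Submodule F (Fin r × Fin ℓ → F)}
    (he : e ∈ edgeLeads g b K) (hb : e.2 + 1 ≠ b) : (e.1, e.2 + 1) ∈ leads (cutRank b) K := by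
  obtain ⟨u, hu, hne, htop⟩ := mem_edgeLeads.mp he
  refine mem_leads.mpr ⟨_, hu.2 (g e.2).2, ?_, fun t => push_endpoint_self_eq_zero htop hb⟩
  have := push_endpoint_apply hg (β := (g e.2).2) (label_of_mem_edgeSpace hu) rfl
  rw [endpoint_self] at this
  rwa [this]

theorem sum_finrank_edgeSpace_le [Fintype ι] (hg : CyclicallyReduced g)
    (K : Submodule F (Fin r × Fin ℓ → F)) : ∑ j, finrank F (edgeSpace g K j) ≤ finrank F K := by
  rw [← card_edgeLeads (b := 0), ← card_leads (cutRank_injective 0)]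
  exact Finset.card_le_card (edgeLeads_subset_leads hg 0 K)

theorem edgeLeads_eq_leads [Fintype ι] (hg : CyclicallyReduced g)
    {K : Submodule F (Fin r × Fin ℓ → F)} (hK : finrank F K ≤ ∑ j, finrank F (edgeSpace g K j))
    (b : Fin ℓ) : edgeLeads g b K = leads (cutRank b) K := by
  apply Finset.eq_of_subset_of_card_le (edgeLeads_subset_leads hg b K)
  rwa [card_edgeLeads, card_leads (cutRank_injective b)]

/-- The `i`-th components of the vectors of `K` whose later components vanish. -/
def blockSpace (K : Submodule F (Fin r × Fin ℓ → F)) (i : Fin r) : Submodule F (Fin ℓ → F) :=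
  (K ⊓ ⨅ p : {p : Fin r × Fin ℓ // i < p.1}, LinearMap.ker (LinearMap.proj p.1)).map
    (LinearMap.funLeft F F (Prod.mk i))

theorem mem_leads_blockSpace {K : Submodule F (Fin r × Fin ℓ → F)} {i : Fin r} {s : Fin ℓ} :
    s ∈ leads (· - b) (blockSpace K i) ↔ (i, s) ∈ leads (cutRank b) K := by
  simp only [mem_leads, blockSpace, Submodule.mem_map, Submodule.mem_inf, Submodule.mem_iInf,
    LinearMap.mem_ker, LinearMap.proj_apply, Subtype.forall]
  constructor
  · rintro ⟨_, ⟨u, ⟨huK, hu⟩, rfl⟩, hne, htop⟩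
    refine ⟨u, huK, hne, fun t ht => ?_⟩
    obtain ⟨i', t⟩ := t
    rcases cutRank_lt.mp ht with h | ⟨rfl, h⟩
    · exact hu _ h
    · exact htop t h
  · rintro ⟨u, hu, hne, htop⟩
    exact ⟨_, ⟨u, ⟨hu, fun p hp => htop p (cutRank_lt.mpr (Or.inl hp))⟩, rfl⟩, hne,
      fun t ht => htop _ (cutRank_lt.mpr (Or.inr ⟨rfl, ht⟩))⟩

theorem mem_iff_of_succ_closed {S : Finset (Fin ℓ)} (hS : ∀ s ∈ S, s + 1 ≠ 0 → s + 1 ∈ S)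
    (d : Fin ℓ) : d ∈ S ↔ ℓ ≤ d.val + S.card := by
  have hup : ∀ n (s t : Fin ℓ), s ∈ S → t.val = s.val + n → t ∈ S := by
    intro n
    induction n with
    | zero => intro s t hs h; rwa [Fin.ext h]
    | succ n ih =>
      intro s t hs h
      let t' : Fin ℓ := ⟨s.val + n, by omega⟩
      have ht' : t' + 1 = t := by
        apply Fin.ext
        have := t.isLt
        rw [Fin.val_add_one_of_lt' (by simp only [t']; omega)]
        simp only [t']
        omega
      rw [← ht']
      apply hS _ (ih s t' hs rfl)
      rw [ht']
      intro h0
      rw [h0] at h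
      simp at h
  constructor
  · intro hd
    have h : Finset.Ici d ⊆ S := fun t ht => by
      have : d ≤ t := by simpa using ht
      exact hup (t.val - d.val) d t hd (by rw [Fin.le_def] at this; omega)
    have := Finset.card_le_card h
    rw [Fin.card_Ici] at this
    omega
  · intro hd
    by_contra hdS
    have h : S ⊆ Finset.Ioi d := fun t ht => by
      rw [Finset.mem_Ioi]
      by_contra hle
      rw [not_lt, Fin.le_def] at hle
      exact hdS (hup (d.val - t.val) t d ht (by omega))
    have := Finset.card_le_card h
    rw [Fin.card_Ioi] at this
    have := d.isLt
    omega

theorem le_of_add_one_eq_zero {x : Fin ℓ} (hx : x + 1 = 0) (d : Fin ℓ) : d ≤ x := by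
  by_contra h
  rw [not_le, Fin.lt_def] at h
  have := d.isLt
  have h1 := Fin.val_add_one_of_lt' (i := x) (by omega)
  rw [hx] at h1
  simp at h1

theorem mem_leads_iff_of_edgeLeads_eq (hg : CyclicallyReduced g)
    {K : Submodule F (Fin r × Fin ℓ → F)} (hE : ∀ b, edgeLeads g b K = leads (cutRank b) K)
    (i : Fin r) (b d : Fin ℓ) :
    (i, b + d) ∈ leads (cutRank b) K ↔ ℓ ≤ d.val + finrank F (blockSpace K i) := by
  classical
  have hcard : finrank F (blockSpace K i)
      = (Finset.univ.filter fun d => (i, b + d) ∈ leads (cutRank b) K).card := by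
    rw [← card_leads (rk := (· - b)) (sub_left_injective)]
    apply Finset.card_bij' (fun s _ => s - b) (fun d _ => b + d)
    · intro s hs
      simpa using mem_leads_blockSpace.mp hs
    · intro d hd
      exact mem_leads_blockSpace.mpr (by simpa using hd)
    · simp
    · simp
  rw [hcard, ← mem_iff_of_succ_closed]
  · simp
  · intro s hs hs0
    simp only [Finset.mem_filter, Finset.mem_univ, true_and] at hs ⊢
    rw [← add_assoc]
    rw [← hE b] at hs
    apply succ_mem_leads hg hs
    simp only [add_assoc]
    simpa using hs0

theorem notMem_leads_of_forall_base (hg : CyclicallyReduced g) (hper : Aperiodic g)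
    {K : Submodule F (Fin r × Fin ℓ → F)} (hE : ∀ b, edgeLeads g b K = leads (cutRank b) K)
    {i : Fin r} (h0 : ∀ b, (i, b) ∉ leads (cutRank b) K) (b s : Fin ℓ) :
    (i, s) ∉ leads (cutRank b) K := by
  intro hs
  have hmem := mem_leads_iff_of_edgeLeads_eq hg hE i
  set m := finrank F (blockSpace K i)
  have hm : 0 < m := by
    have := (hmem b (s - b)).mp (by simpa using hs)
    have := (s - b).isLt
    omega
  have hml : m < ℓ := by
    have := (hmem 0 0).not.mp (by simpa using h0 0)
    simpa using this
  obtain ⟨t, ht⟩ : ∃ t : Fin ℓ, t.val = ℓ - m := ⟨⟨ℓ - m, by omega⟩, rfl⟩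
  have ht0 : t ≠ 0 := by
    rintro rfl
    simp at ht
    omega
  refine ht0 (hper t fun b => ?_)
  have hlead := (hmem b t).mpr (by omega)
  rw [← hE b] at hlead
  obtain ⟨u, hu, hne, htop⟩ := mem_edgeLeads.mp hlead
  simp only at hu
  set β := (g (b + t)).2 with hβ
  have hR := hu.2 (!β)
  have hRtop := fun p => push_endpoint_not_self_eq_zero (g := g) htop (t := p)
  have hRne := push_endpoint_apply hg (β := !β) (e := (i, b + t)) (label_of_mem_edgeSpace hu) rfl
  have hep : endpoint g (!β) (i, b + t) = (i, b + t) := endpoint_not_self g (i, b + t)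
  rw [hep] at hRne
  simp only [← hβ] at hRtop
  set R := push (endpoint g (!β)) u with hRdef
  have hsucc : (t - 1).val + 1 = t.val := by
    have := Fin.val_add_one_of_ne_zero (d := t - 1) (by simpa using ht0)
    simpa using this.symm
  have hRb : R (i, b) ≠ 0 := by
    intro hRb
    have : (i, (b + 1) + (t - 1)) ∈ leads (cutRank (b + 1)) K := by
      have h1 : b + 1 + (t - 1) = b + t := by abel
      rw [h1]
      refine mem_leads.mpr ⟨R, hR, by rwa [hRne], fun p hp => ?_⟩
      rcases cutRank_lt.mp hp with h | ⟨h, h'⟩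
      · exact hRtop _ (cutRank_lt.mpr (Or.inl h))
      · by_cases hpb : p.2 = b
        · rw [← hRb, ← hpb]
          congr 1
          exact Prod.ext h.symm rfl
        · apply hRtop _ (cutRank_lt.mpr (Or.inr ⟨h, ?_⟩))
          have h2 : p.2 - b = (p.2 - (b + 1)) + 1 := by abel
          have h3 := Fin.val_add_one_of_ne_zero (d := p.2 - (b + 1))
            (by rw [← h2]; exact sub_ne_zero.mpr hpb)
          have h4 : b + t - (b + 1) = t - 1 := by abel
          simp only [h4, Fin.lt_def] at h'
          simp only [add_sub_cancel_left, Fin.lt_def, h2, h3]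
          omega
    have := (hmem _ _).mp this
    omega
  obtain ⟨f, hf, huf⟩ := exists_of_push_ne_zero hRb
  have hlab := label_of_mem_edgeSpace hu f huf
  obtain ⟨i', f⟩ := f
  simp only [endpoint, Prod.mk.injEq] at hf hlab
  obtain ⟨rfl, hf⟩ := hf
  split_ifs at hf with hsg
  · exfalso
    have hle : ¬ cutRank b (i', b + t) < cutRank b (i', f) := fun h => huf (htop _ h)
    rw [cutRank_lt] at hle
    push Not at hle
    have h1 := hle.2 rfl
    have h2 := le_of_add_one_eq_zero (x := f - b) (by rw [← hf]; abel) (b + t - b)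
    have h3 : f = b + t := sub_left_injective (le_antisymm h1 h2)
    rw [h3, ← hβ] at hsg
    simp at hsg
  · subst hf
    refine (Prod.ext hlab ?_).symm
    simpa using hsg

theorem forall_base_mem_leads (hg : CyclicallyReduced g)
    {K : Submodule F (Fin r × Fin ℓ → F)} (hE : ∀ b, edgeLeads g b K = leads (cutRank b) K)
    {i : Fin r} {b : Fin ℓ} (hb : (i, b) ∈ leads (cutRank b) K) (c : Fin ℓ) :
    (i, c) ∈ leads (cutRank c) K := by
  have hstep : ∀ b, (i, b) ∈ leads (cutRank b) K → (i, b + 1) ∈ leads (cutRank (b + 1)) K := by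
    intro b hb
    rw [← hE b] at hb
    obtain ⟨u, hu, hne, htop⟩ := mem_edgeLeads.mp hb
    have hv := push_endpoint_apply hg (β := (g b).2) (e := (i, b)) (label_of_mem_edgeSpace hu) rfl
    rw [endpoint_self g (i, b)] at hv
    refine mem_leads.mpr ⟨_, hu.2 (g b).2, by rwa [hv], fun p hp => ?_⟩
    by_contra hp0
    obtain ⟨f, rfl, huf⟩ := exists_of_push_ne_zero hp0
    have hle : ¬ cutRank b (i, b) < cutRank b f := fun h => huf (htop _ h)
    rw [cutRank_lt] at hle hp
    push Not at hle
    simp only [endpoint, sub_self] at hp hle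
    rcases hp with hp | ⟨rfl, hp⟩
    · exact absurd hp hle.1.not_gt
    · have hf : f.2 = b := by
        have h1 : f.2 - b = 0 := le_antisymm (hle.2 rfl) (Fin.zero_le _)
        exact sub_eq_zero.mp h1
      simp [hf] at hp
  have hall : ∀ n : ℕ, (i, b + Fin.ofNat ℓ n) ∈ leads (cutRank (b + Fin.ofNat ℓ n)) K := by
    intro n
    induction n with
    | zero => simpa using hb
    | succ n ih =>
      have : b + Fin.ofNat ℓ (n + 1) = b + Fin.ofNat ℓ n + 1 := by
        rw [add_assoc]
        congr 1
        ext
        simp [Fin.val_add]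
      rw [this]
      exact hstep _ ih
  have := hall (c - b).val
  simpa using this

theorem Fin.val_nsmul_one (x : Fin ℓ) : x.val • (1 : Fin ℓ) = x := by
  have h : ∀ n : ℕ, n • (1 : Fin ℓ) = Fin.ofNat ℓ n := by
    intro n
    induction n with
    | zero => simp
    | succ n ih =>
      rw [succ_nsmul, ih]
      ext
      simp [Fin.val_add]
  rw [h]
  simp

/-- A relation between positions of an aperiodic cyclically reduced cyclic word which is preserved
by reading the word simultaneously from both positions (in either direction from the second) is
contained in the diagonal. -/
theorem eq_of_parallel_reading (hg : CyclicallyReduced g) (hper : Aperiodic g)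
    {R : Fin ℓ → Fin ℓ → Prop}
    (hR : ∀ e t, R e t → (g t = g e ∧ R (e + 1) (t + 1)) ∨
      (((g (t - 1)).1 = (g e).1 ∧ (g (t - 1)).2 = !(g e).2) ∧ R (e + 1) (t - 1)))
    {e t : Fin ℓ} (het : R e t) : e = t := by
  rcases hR e t het with ⟨h1, h2⟩ | ⟨h1, h2⟩
  · have key : ∀ n : ℕ, g (t + n • 1) = g (e + n • 1) ∧
        R (e + n • 1 + 1) (t + n • 1 + 1) := by
      intro n
      induction n with
      | zero => simpa using ⟨h1, h2⟩
      | succ n ih =>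
        rcases hR _ _ ih.2 with h | ⟨⟨h, h'⟩, -⟩
        · simpa only [succ_nsmul, add_assoc] using h
        · exfalso
          rw [add_sub_cancel_right, ih.1] at h h'
          have := hg _ h
          rw [← this] at h'
          simp at h'
    refine (sub_eq_zero.mp (hper (t - e) fun b => ?_)).symm
    have := (key (b - e).val).1
    rw [Fin.val_nsmul_one] at this
    convert this using 2 <;> abel
  · exfalso
    have key : ∀ n : ℕ, ((g (t - n • 1 - 1)).1 = (g (e + n • 1)).1 ∧
        (g (t - n • 1 - 1)).2 = !(g (e + n • 1)).2) ∧ R (e + n • 1 + 1) (t - n • 1 - 1) := by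
      intro n
      induction n with
      | zero => simpa using ⟨h1, h2⟩
      | succ n ih =>
        rcases hR _ _ ih.2 with ⟨h, -⟩ | h
        · exfalso
          have h3 := ih.1
          rw [h] at h3
          have := hg _ h3.1.symm
          rw [this] at h3
          simp at h3
        · simpa only [succ_nsmul, ← add_assoc, ← sub_sub] using h
    obtain ⟨m, hm | hm⟩ := Nat.even_or_odd' (t - e).val
    · have ht : t = e + (m • 1 + m • 1) := by
        have := Fin.val_nsmul_one (t - e)
        rw [hm, two_mul, add_nsmul] at this
        rw [this]
        abel
      have h := (key m).1
      generalize m • (1 : Fin ℓ) = x at h ht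
      have h4 : t - x - 1 = e + x - 1 := by rw [ht]; abel
      have h5 := hg (e + x - 1)
      rw [sub_add_cancel, ← h4] at h5
      have := h5 h.1
      rw [this] at h
      simp at h
    · have ht : t = e + (m • 1 + m • 1 + 1) := by
        have := Fin.val_nsmul_one (t - e)
        rw [hm, two_mul, add_nsmul, add_nsmul, one_nsmul] at this
        rw [this]
        abel
      have h := (key m).1
      generalize m • (1 : Fin ℓ) = x at h ht
      have h4 : t - x - 1 = e + x := by rw [ht]; abel
      rw [h4] at h
      simp at h

theorem exists_single_of_base_mem_leads {K : Submodule F (Fin r × Fin ℓ → F)} {i : Fin r}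
    (hb : (i, b) ∈ leads (cutRank b) K) :
    ∃ u ∈ K, (∀ p, i < p.1 → u p = 0) ∧ u (i, b) = 1 ∧ ∀ s, s ≠ b → u (i, s) = 0 := by
  obtain ⟨u, hu, hne, htop⟩ := mem_leads.mp hb
  refine ⟨(u (i, b))⁻¹ • u, K.smul_mem _ hu, fun p hp => ?_, ?_, fun s hs => ?_⟩
  · simp [htop p (cutRank_lt.mpr (Or.inl hp))]
  · simp [hne]
  · have : u (i, s) = 0 := htop _ (cutRank_lt.mpr (Or.inr ⟨rfl, by
      simpa [Fin.pos_iff_ne_zero, sub_eq_zero] using hs⟩))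
    simp [this]

/-- If `K` contains no nonzero vector supported on the vertices `(i, 0)`, then the Euler
characteristic of `K` is positive unless `K = ⊥`. -/
theorem eq_bot_of_finrank_le [Fintype ι] (hg : CyclicallyReduced g) (hper : Aperiodic g)
    {K : Submodule F (Fin r × Fin ℓ → F)} (hK : finrank F K ≤ ∑ j, finrank F (edgeSpace g K j))
    (hslice : ∀ z ∈ K, (∀ p, p.2 ≠ 0 → z p = 0) → z = 0) : K = ⊥ := by
  have hE := edgeLeads_eq_leads hg hK
  by_contra hbot
  obtain ⟨z, hzK, hz⟩ := Submodule.exists_mem_ne_zero_of_ne_bot hbot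
  have hex : ∃ i : Fin r, ∃ s, (i, s) ∈ leads (cutRank 0) K := by
    obtain ⟨p, hp⟩ := exists_last_ne_zero (cutRank 0) hz
    exact ⟨p.1, p.2, mem_leads.mpr ⟨z, hzK, hp⟩⟩
  obtain ⟨i, ⟨s, his⟩, hmin⟩ := wellFounded_lt.has_min {i : Fin r | ∃ s, (i, s) ∈
    leads (cutRank 0) K} hex
  have huniq : ∀ z ∈ K, (∀ p, i ≤ p.1 → z p = 0) → z = 0 := by
    intro z hz h
    by_contra hne
    obtain ⟨p, hp⟩ := exists_last_ne_zero (cutRank 0) hne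
    apply hmin p.1 ⟨p.2, mem_leads.mpr ⟨z, hz, hp⟩⟩
    by_contra hlt
    exact hp.1 (h p (not_lt.mp hlt))
  have hbase : ∀ c, (i, c) ∈ leads (cutRank c) K := by
    by_contra hne
    have h0 : ∀ c, (i, c) ∉ leads (cutRank c) K := fun c hc =>
      hne fun d => forall_base_mem_leads hg hE hc d
    exact notMem_leads_of_forall_base hg hper hE h0 _ _ his
  choose κ hκK hκtop hκone hκ using fun s => exists_single_of_base_mem_leads (hbase s)
  have hedge : ∀ e, ∃ u ∈ edgeSpace g K (g e).1, ∀ β, push (endpoint g β) u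
      = κ (endpoint g β (i, e)).2 := by
    intro e
    have he := hbase e
    rw [← hE e] at he
    have he' : (i, e) ∈ leads (cutRank e) (edgeSpace g K (g e).1) :=
      mem_leads.mpr (mem_edgeLeads.mp he)
    obtain ⟨u, hu, htop, hone, hu0⟩ := exists_single_of_base_mem_leads he'
    refine ⟨u, hu, fun β => sub_eq_zero.mp (huniq _ (K.sub_mem (hu.2 β) (hκK _)) fun p hp => ?_)⟩
    rw [Pi.sub_apply, sub_eq_zero]
    obtain ⟨i', p⟩ := p
    rcases hp.lt_or_eq with hlt | heq
    · rw [hκtop _ _ hlt]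
      by_contra hne
      obtain ⟨f, hf, huf⟩ := exists_of_push_ne_zero hne
      refine huf (htop f ?_)
      simp only [endpoint, Prod.mk.injEq] at hf
      rwa [hf.1]
    · simp only at heq
      subst heq
      have hsupp : ∀ f, u (i, f) ≠ 0 → f = e := fun f hf => by
        by_contra hfe
        exact hf (hu0 f hfe)
      by_cases hpe : p = (endpoint g β (i, e)).2
      · rw [hpe, hκone, ← hone]
        have : (i, (endpoint g β (i, e)).2) = endpoint g β (i, e) := rfl
        rw [this]
        exact push_endpoint_apply hg (label_of_mem_edgeSpace hu) rfl
      · rw [hκ _ _ hpe]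
        by_contra hne
        obtain ⟨⟨i', f⟩, hf, huf⟩ := exists_of_push_ne_zero hne
        have hi : i' = i := congrArg Prod.fst hf
        subst hi
        obtain rfl := hsupp f huf
        exact hpe (congrArg Prod.snd hf).symm
  have hdiag : ∀ i' e t, κ e (i', t) ≠ 0 → e = t := by
    intro i' e t het
    refine eq_of_parallel_reading hg hper (R := fun e t => κ e (i', t) ≠ 0) ?_ het
    intro e t het
    obtain ⟨u, hu, hpush⟩ := hedge e
    have h1 := hpush (!(g e).2)
    have h2 := hpush (g e).2
    rw [endpoint_not_self g (i, e)] at h1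
    rw [endpoint_self g (i, e)] at h2
    simp only at h1 h2
    rw [← h1] at het
    obtain ⟨⟨i'', f⟩, hf, huf⟩ := exists_of_push_ne_zero het
    have hlab : (g f).1 = (g e).1 := label_of_mem_edgeSpace hu _ huf
    have h3 := push_endpoint_apply hg (β := (g e).2) (e := (i'', f)) (label_of_mem_edgeSpace hu)
      hlab
    rw [h2] at h3
    simp only [endpoint, Prod.mk.injEq] at hf h3
    obtain ⟨rfl, hf⟩ := hf
    by_cases hsg : (g f).2 = (g e).2
    · left
      have hne : ¬ (g f).2 = !(g e).2 := by rw [hsg]; simp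
      rw [if_neg hne] at hf
      rw [if_pos hsg] at h3
      subst hf
      exact ⟨Prod.ext hlab hsg, by rwa [h3]⟩
    · right
      have hsg' : (g f).2 = !(g e).2 := by simpa using Bool.eq_not_of_ne hsg
      rw [if_pos hsg'] at hf
      rw [if_neg hsg] at h3
      subst hf
      rw [add_sub_cancel_right]
      exact ⟨⟨hlab, hsg'⟩, by rwa [h3]⟩
  have := hslice (κ 0) (hκK 0) fun p hp => by
    by_contra hne
    exact hp (hdiag p.1 0 p.2 hne).symm
  have h1 := hκone 0
  rw [this] at h1
  simp at h1

variable (g) in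
/-- Membership in `K` is invariant under moving along all the edges with a given label. -/
def Consistent (K : Submodule F (Fin r × Fin ℓ → F)) : Prop :=
  ∀ (j : ι) (u : Fin r × Fin ℓ → F), (∀ e, (g e.2).1 ≠ j → u e = 0) →
    ∀ β β', push (endpoint g β) u ∈ K → push (endpoint g β') u ∈ K

theorem le_of_leads_generate (hg : CyclicallyReduced g) {K K' : Submodule F (Fin r × Fin ℓ → F)}
    (hK' : Consistent g K')
    (hgen : ∀ p ∈ leads (cutRank 0) K,
      (∀ e ∈ edgeLeads g 0 K, e.2 + 1 ≠ 0 → (e.1, e.2 + 1) ≠ p) →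
      ∃ z ∈ K ⊓ K', z p ≠ 0 ∧ ∀ t, cutRank 0 p < cutRank 0 t → z t = 0) : K ≤ K' := by
  have key : ∀ (o : Fin r ×ₗ Fin ℓ) (p : Fin r × Fin ℓ), cutRank 0 p = o → ∀ z ∈ K,
      (∀ t, cutRank 0 p < cutRank 0 t → z t = 0) → z ∈ K' := by
    intro o
    induction o using WellFoundedLT.induction with
    | _ o ih =>
    rintro p rfl z hz htop
    have hlow : ∀ z ∈ K, (∀ t, cutRank 0 p < cutRank 0 t → z t = 0) → z p = 0 → z ∈ K' := by
      intro z hz htop hp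
      by_cases hz0 : z = 0
      · rw [hz0]; exact K'.zero_mem
      · obtain ⟨p', hp', htop'⟩ := exists_last_ne_zero (cutRank 0) hz0
        have hlt : cutRank 0 p' < cutRank 0 p := by
          rcases lt_trichotomy (cutRank 0 p') (cutRank 0 p) with h | h | h
          · exact h
          · exact absurd (cutRank_injective 0 h ▸ hp) hp'
          · exact absurd (htop _ h) hp'
        exact ih _ hlt p' rfl z hz htop'
    by_cases hzp : z p = 0
    · exact hlow z hz htop hzp
    suffices h : ∃ y ∈ K ⊓ K', y p ≠ 0 ∧ ∀ t, cutRank 0 p < cutRank 0 t → y t = 0 by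
      obtain ⟨y, ⟨hyK, hyK'⟩, hyp, hytop⟩ := h
      have := hlow (z - (z p / y p) • y) (K.sub_mem hz (K.smul_mem _ hyK))
        (fun t ht => by simp [htop t ht, hytop t ht]) (by simp [hyp])
      simpa using K'.add_mem this (K'.smul_mem (z p / y p) hyK')
    by_cases hp : ∀ e ∈ edgeLeads g 0 K, e.2 + 1 ≠ 0 → (e.1, e.2 + 1) ≠ p
    · exact hgen p (mem_leads.mpr ⟨z, hz, hzp, htop⟩) hp
    · push Not at hp
      obtain ⟨e, he, he0, rfl⟩ := hp
      obtain ⟨u, hu, hne, hutop⟩ := mem_edgeLeads.mp he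
      have hy := push_endpoint_apply hg (β := (g e.2).2) (label_of_mem_edgeSpace hu) rfl
      rw [endpoint_self] at hy
      refine ⟨push (endpoint g (g e.2).2) u, ⟨hu.2 _, ?_⟩, by rwa [hy],
        fun t => push_endpoint_self_eq_zero hutop he0⟩
      apply hK' _ u hu.1 (!(g e.2).2)
      exact ih _ (cutRank_lt_succ he0) e rfl _ (hu.2 _)
        fun t => push_endpoint_not_self_eq_zero hutop
  intro z hz
  by_cases hz0 : z = 0
  · rw [hz0]; exact K'.zero_mem
  · obtain ⟨p, -, htop⟩ := exists_last_ne_zero (cutRank 0) hz0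
    exact key _ p rfl z hz htop

/-- A space `K` of Euler characteristic `c` is determined among consistent spaces by `c + r` of its
vectors. -/
theorem exists_generators [Fintype ι] (hg : CyclicallyReduced g)
    (K : Submodule F (Fin r × Fin ℓ → F)) {m : ℕ}
    (hm : finrank F K + r ≤ m + ∑ j, finrank F (edgeSpace g K j)) :
    ∃ f : Fin m → Fin r × Fin ℓ → F, (∀ n, f n ∈ K) ∧
      ∀ K', Consistent g K' → (∀ n, f n ∈ K') → K ≤ K' := by
  classical
  let good : Finset (Fin r × Fin ℓ) := {e ∈ edgeLeads g 0 K | e.2 + 1 ≠ 0}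
  let T := good.image fun e => (e.1, e.2 + 1)
  let J := leads (cutRank 0) K \ T
  have hTcard : T.card = good.card := by
    apply Finset.card_image_of_injective
    rintro ⟨i, s⟩ ⟨i', s'⟩ h
    simpa using h
  have hbad : (edgeLeads g 0 K).card ≤ good.card + r := by
    rw [← Finset.card_filter_add_card_filter_not (s := edgeLeads g 0 K) (fun e => e.2 + 1 ≠ 0)]
    apply Nat.add_le_add_left
    refine (Finset.card_le_card_of_injOn Prod.fst (t := Finset.univ) (by simp) ?_).trans
      (Finset.card_fin r).le
    rintro ⟨i, s⟩ hs ⟨i', s'⟩ hs' h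
    simp only [ne_eq, not_not, Finset.coe_filter, Set.mem_ofPred_eq] at hs hs' h
    rw [h, add_right_cancel (hs.2.trans hs'.2.symm)]
  have hTsub : T ⊆ leads (cutRank 0) K := by
    intro p hp
    obtain ⟨e, he, rfl⟩ := Finset.mem_image.mp hp
    rw [Finset.mem_filter] at he
    exact succ_mem_leads hg he.1 he.2
  have hJ : J.card ≤ m := by
    have h1 := Finset.card_sdiff_add_card_eq_card hTsub
    rw [card_edgeLeads] at hbad
    rw [card_leads (cutRank_injective 0)] at h1
    change J.card + _ = _ at h1
    omega
  choose κ hκK hκne hκtop using fun p : J =>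
    mem_leads.mp (Finset.mem_sdiff.mp p.2).1
  obtain ⟨φ⟩ : Nonempty (J ↪ Fin m) :=
    Function.Embedding.nonempty_of_card_le (by simpa using hJ)
  refine ⟨Function.extend φ κ 0, fun n => ?_, fun K' hK' hf => le_of_leads_generate hg hK' ?_⟩
  · by_cases hn : ∃ p, φ p = n
    · obtain ⟨p, rfl⟩ := hn
      rw [φ.injective.extend_apply]
      exact hκK p
    · rw [Function.extend_apply' _ _ _ hn]
      exact K.zero_mem
  · intro p hp hpT
    have hpJ : p ∈ J := by
      refine Finset.mem_sdiff.mpr ⟨hp, fun hT => ?_⟩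
      obtain ⟨e, he, rfl⟩ := Finset.mem_image.mp hT
      rw [Finset.mem_filter] at he
      exact hpT e he.1 he.2 rfl
    have := hf (φ ⟨p, hpJ⟩)
    rw [φ.injective.extend_apply] at this
    exact ⟨κ ⟨p, hpJ⟩, ⟨hκK _, this⟩, hκne _, hκtop ⟨p, hpJ⟩⟩

/-- There are few consistent spaces of Euler characteristic `c`. -/
theorem card_consistent_le [Fintype ι] [Fintype F] (hg : CyclicallyReduced g) (c : ℕ)
    (𝒦 : Finset (Submodule F (Fin r × Fin ℓ → F)))
    (h𝒦 : ∀ K ∈ 𝒦, Consistent g K ∧ finrank F K ≤ c + ∑ j, finrank F (edgeSpace g K j)) :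
    𝒦.card ≤ Fintype.card F ^ (r * ℓ * (c + r)) := by
  classical
  choose f hfK hf using fun K : 𝒦 => exists_generators (m := c + r) hg K.1
    (by have := (h𝒦 K.1 K.2).2; omega)
  have hinj : Function.Injective f := by
    intro K₁ K₂ h
    apply Subtype.ext
    apply le_antisymm
    · exact hf K₁ _ (h𝒦 _ K₂.2).1 (by rw [h]; exact hfK K₂)
    · exact hf K₂ _ (h𝒦 _ K₁.2).1 (by rw [← h]; exact hfK K₁)
  have := Fintype.card_le_of_injective f hinj
  simpa [← pow_mul, mul_comm, mul_left_comm] using this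
end Spaces
end Cycles

section LinearGroup

open Matrix

variable {F : Type*} [Field F] {n : ℕ}

theorem exists_generalLinearGroup_mulVec_eq {d : ℕ} {a b : Fin d → Fin n → F}
    (ha : LinearIndependent F a) (hb : LinearIndependent F b) :
    ∃ h : GL (Fin n) F, ∀ i, h.1 *ᵥ a i = b i := by
  obtain ⟨f, hf⟩ := Submodule.exists_linearEquiv_restrict_eq
    ((Basis.span ha).equiv (Basis.span hb) (Equiv.refl _))
  let h := Matrix.GeneralLinearGroup.toLin.symm (LinearMap.GeneralLinearGroup.ofLinearEquiv f)
  refine ⟨h, fun i => ?_⟩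
  have h1 : ∀ x, h.1 *ᵥ x = f x := fun x => by
    have h2 : Matrix.GeneralLinearGroup.toLin h = LinearMap.GeneralLinearGroup.ofLinearEquiv f :=
      MulEquiv.apply_symm_apply _ _
    have h3 := congrArg (fun y : LinearMap.GeneralLinearGroup F (Fin n → F) => y.1 x) h2
    simpa [Matrix.GeneralLinearGroup.coe_toLin] using h3
  have h4 := hf (Basis.span ha i)
  rw [Basis.equiv_apply] at h4
  simpa [Basis.span_apply, h1] using h4.symm

theorem generalLinearGroup_mulVec_injective (x : GL (Fin n) F) :
    Function.Injective (fun v => x.1 *ᵥ v) :=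
  Matrix.mulVec_injective_of_isUnit ⟨x, rfl⟩

theorem linearIndependent_mulVec {I : Type*} {a : I → Fin n → F} (ha : LinearIndependent F a)
    (x : GL (Fin n) F) : LinearIndependent F fun i => x.1 *ᵥ a i :=
  ha.map' (Matrix.mulVecLin x.1)
    (LinearMap.ker_eq_bot.mpr (generalLinearGroup_mulVec_injective x))

theorem card_mulVec_eq_mul_le [Fintype F] {I : Type*} [Finite I] (a b : I → Fin n → F) {d : ℕ}
    (hd : d ≤ finrank F (Submodule.span F (Set.range a))) :
    Nat.card {x : GL (Fin n) F // ∀ i, x.1 *ᵥ a i = b i} *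
      ∏ i : Fin d, (Fintype.card F ^ n - Fintype.card F ^ (i : ℕ)) ≤ Nat.card (GL (Fin n) F) := by
  obtain ⟨c, hcr, -, hc⟩ := Submodule.exists_fun_fin_finrank_span_eq F (Set.range a)
  have hc' : LinearIndependent F (c ∘ Fin.castLE hd) := hc.comp _ (Fin.castLE_injective hd)
  set c' := c ∘ Fin.castLE hd
  have hca : ∀ i, ∃ j, a j = c' i := fun i => hcr _
  choose σ hσ using hca
  have hdn : d ≤ finrank F (Fin n → F) := hd.trans (Submodule.finrank_le _)
  have hcard := card_linearIndependent (K := F) (V := Fin n → F) hdn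
  rw [Module.finrank_fin_fun] at hcard
  rw [← hcard, ← Nat.card_prod]
  by_cases hne : Nonempty {x : GL (Fin n) F // ∀ i, x.1 *ᵥ a i = b i}
  swap
  · rw [not_nonempty_iff] at hne
    simp
  obtain ⟨x₀, hx₀⟩ := hne
  have hb : LinearIndependent F (fun i => b (σ i)) := by
    have := linearIndependent_mulVec hc' x₀
    simpa only [← hσ, hx₀] using this
  choose h hh using fun y : {s : Fin d → Fin n → F // LinearIndependent F s} =>
    exists_generalLinearGroup_mulVec_eq hb y.2
  refine Nat.card_le_card_of_injective (fun p => h p.2 * p.1.1) ?_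
  rintro ⟨x, y⟩ ⟨x', y'⟩ hxy
  simp only at hxy
  have key : ∀ (x : {x : GL (Fin n) F // ∀ i, x.1 *ᵥ a i = b i}) y i,
      (h y * x.1).1 *ᵥ c' i = y.1 i := fun x y i => by
    rw [← hσ, Units.val_mul, ← Matrix.mulVec_mulVec, x.2, hh]
  have hy : y = y' := Subtype.ext (funext fun i => by rw [← key x, ← key x', hxy])
  subst hy
  rw [mul_right_inj] at hxy
  exact Prod.ext (Subtype.ext hxy) rfl

end LinearGroup

section Relations

open Matrix

theorem card_relations_le {F I : Type*} [Field F] [Fintype F] [Fintype I] {n : ℕ}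
    (K : Submodule F (I → F)) :
    Nat.card {T : I → Fin n → F // K ≤ LinearMap.ker (Fintype.linearCombination F T)} ≤
      Fintype.card F ^ (n * (Fintype.card I - finrank F K)) := by
  classical
  have hfin : Finite (((I → F) ⧸ K) →ₗ[F] (Fin n → F)) := Module.finite_of_finite F
  have h1 : Nat.card (((I → F) ⧸ K) →ₗ[F] (Fin n → F)) =
      Fintype.card F ^ (n * (Fintype.card I - finrank F K)) := by
    rw [Module.natCard_eq_pow_finrank (K := F), Module.finrank_linearMap,
      Submodule.finrank_quotient, Module.finrank_fin_fun, Module.finrank_fintype_fun_eq_card,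
      mul_comm, Nat.card_eq_fintype_card]
  rw [← h1]
  refine Nat.card_le_card_of_injective
    (fun T => K.liftQ (Fintype.linearCombination F T.1) T.2) fun T T' h => ?_
  ext i : 2
  have h2 := LinearMap.congr_fun h (K.mkQ (Pi.single i 1))
  simpa [Fintype.linearCombination_apply_single] using h2

theorem linearCombination_push {F A I M : Type*} [Field F] [Fintype A] [Fintype I] [DecidableEq I]
    [AddCommGroup M] [Module F M] (T : I → M) (f : A → I) (u : A → F) :
    Fintype.linearCombination F T (push f u) = Fintype.linearCombination F (T ∘ f) u := by
  simp only [Fintype.linearCombination_apply, push_apply, Finset.sum_smul, ite_smul, zero_smul]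
  rw [Finset.sum_comm]
  simp

variable {ℓ r n : ℕ} [NeZero ℓ] {ι F : Type*} [Field F] {g : Fin ℓ → ι × Bool}
  {T : Fin r × Fin ℓ → Fin n → F}

variable (g T) in
/-- The matrices that move the `true` end of every edge with label `j` to its `false` end, when the
vertices are placed at `T`. -/
def IsTransport (j : ι) (x : GL (Fin n) F) : Prop :=
  ∀ e : {e : Fin r × Fin ℓ // (g e.2).1 = j}, x.1 *ᵥ T (endpoint g true e) = T (endpoint g false e)

theorem consistent_of_isTransport {x : ι → GL (Fin n) F} (hx : ∀ j, IsTransport g T j (x j)) :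
    Consistent g (LinearMap.ker (Fintype.linearCombination F T)) := by
  intro j u hu
  have key : Fintype.linearCombination F T (push (endpoint g false) u) =
      (x j).1 *ᵥ Fintype.linearCombination F T (push (endpoint g true) u) := by
    rw [linearCombination_push, linearCombination_push, ← Matrix.mulVecLin_apply]
    simp only [Fintype.linearCombination_apply, map_sum, map_smul, Matrix.mulVecLin_apply]
    refine Finset.sum_congr rfl fun e _ => ?_
    by_cases he : (g e.2).1 = j
    · rw [Function.comp_apply, Function.comp_apply, hx j ⟨e, he⟩]
    · simp [hu e he]
  have hiff : push (endpoint g false) u ∈ LinearMap.ker (Fintype.linearCombination F T) ↔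
      push (endpoint g true) u ∈ LinearMap.ker (Fintype.linearCombination F T) := by
    rw [LinearMap.mem_ker, LinearMap.mem_ker, key]
    constructor
    · intro h
      exact generalLinearGroup_mulVec_injective (x j) (by simpa using h)
    · intro h
      rw [h, Matrix.mulVec_zero]
  rintro (_ | _) (_ | _) h
  exacts [h, hiff.mp h, hiff.mpr h, h]

theorem card_label_le [DecidableEq ι]
    (hT : Consistent g (LinearMap.ker (Fintype.linearCombination F T))) (j : ι) :
    Fintype.card {e : Fin r × Fin ℓ // (g e.2).1 = j} ≤
      finrank F (Submodule.span F (Set.range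
        fun e : {e : Fin r × Fin ℓ // (g e.2).1 = j} => T (endpoint g true e))) +
      finrank F (edgeSpace g (LinearMap.ker (Fintype.linearCombination F T)) j) := by
  set a := fun e : {e : Fin r × Fin ℓ // (g e.2).1 = j} => T (endpoint g true e)
  have hrank := LinearMap.finrank_range_add_finrank_ker (Fintype.linearCombination F a)
  rw [Module.finrank_fintype_fun_eq_card, Fintype.range_linearCombination] at hrank
  rw [← hrank]
  refine Nat.add_le_add_left ?_ _
  have hsupp : ∀ (u : {e : Fin r × Fin ℓ // (g e.2).1 = j} → F) (e : Fin r × Fin ℓ),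
      (g e.2).1 ≠ j → push Subtype.val u e = 0 := fun u e he => by
    by_contra hne
    obtain ⟨f, rfl, -⟩ := exists_of_push_ne_zero hne
    exact he f.2
  have hmap : ∀ u ∈ LinearMap.ker (Fintype.linearCombination F a),
      push Subtype.val u ∈ edgeSpace g (LinearMap.ker (Fintype.linearCombination F T)) j := by
    intro u hu
    refine ⟨hsupp u, fun β => hT j _ (hsupp u) true β ?_⟩
    rw [LinearMap.mem_ker, linearCombination_push, linearCombination_push]
    exact hu
  refine LinearMap.finrank_le_finrank_of_injective
    (f := (push Subtype.val).restrict hmap) fun u u' h => ?_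
  ext e : 2
  have h2 := congrFun (congrArg Subtype.val h) e.1
  have hval : ∀ u : {e : Fin r × Fin ℓ // (g e.2).1 = j} → F, push Subtype.val u e.1 = u e :=
    fun u => push_apply_eq fun f hf _ => Subtype.ext hf
  simpa [LinearMap.restrict_apply, hval] using h2

theorem card_isTransport_mul_le [DecidableEq ι] [Fintype F]
    (hT : Consistent g (LinearMap.ker (Fintype.linearCombination F T))) (j : ι) :
    Nat.card {x : GL (Fin n) F // IsTransport g T j x} *
      ∏ i : Fin (Fintype.card {e : Fin r × Fin ℓ // (g e.2).1 = j} -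
        finrank F (edgeSpace g (LinearMap.ker (Fintype.linearCombination F T)) j)),
        (Fintype.card F ^ n - Fintype.card F ^ (i : ℕ)) ≤ Nat.card (GL (Fin n) F) :=
  card_mulVec_eq_mul_le _ (fun e : {e : Fin r × Fin ℓ // (g e.2).1 = j} => T (endpoint g false e))
    (Nat.sub_le_iff_le_add.mpr (card_label_le hT j))

end Relations

section Counting

theorem pow_mul_one_sub_le_prod {q : ℝ} (hq : 1 ≤ q) {n m d : ℕ} (hdm : d ≤ m) (hmn : m ≤ n) :
    (q ^ n * (1 - q ^ m / q ^ n)) ^ d ≤ ∏ i : Fin d, (q ^ n - q ^ (i : ℕ)) := by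
  have hqn : 0 < q ^ n := by positivity
  have hb : q ^ n * (1 - q ^ m / q ^ n) = q ^ n - q ^ m := by field_simp
  rw [hb, ← Fin.prod_const]
  refine Finset.prod_le_prod (fun i _ => sub_nonneg.mpr (pow_le_pow_right₀ hq hmn)) fun i _ => ?_
  exact sub_le_sub_left (pow_le_pow_right₀ hq (i.2.le.trans hdm)) _

variable {ℓ r n : ℕ} [NeZero ℓ] {ι F : Type*} [Fintype ι] [Field F] [Fintype F]
  {g : Fin ℓ → ι × Bool}

theorem sum_consistent_le (hg : CyclicallyReduced g) (hper : Aperiodic g) (hn : r * ℓ ≤ n)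
    (𝒦 : Finset (Submodule F (Fin r × Fin ℓ → F)))
    (h𝒦 : ∀ K ∈ 𝒦, Consistent g K ∧ ∀ z ∈ K, (∀ p, p.2 ≠ 0 → z p = 0) → z = 0) :
    ∑ K ∈ 𝒦, (((Fintype.card F : ℝ) ^ n)⁻¹) ^ (finrank F K - ∑ j, finrank F (edgeSpace g K j)) ≤
      1 + (r * ℓ : ℕ) * ((Fintype.card F : ℝ) ^ (r * ℓ * (r + 1)) / (Fintype.card F : ℝ) ^ n) := by
  classical
  set q := (Fintype.card F : ℝ)
  have hq : 1 ≤ q := Nat.one_le_cast.mpr Fintype.card_pos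
  set χ : Submodule F (Fin r × Fin ℓ → F) → ℕ :=
    fun K => finrank F K - ∑ j, finrank F (edgeSpace g K j)
  have hmaps : ∀ K ∈ 𝒦, χ K ∈ Finset.range (r * ℓ + 1) := fun K _ => by
    have h1 := Submodule.finrank_le K
    simp only [Module.finrank_fintype_fun_eq_card, Fintype.card_prod, Fintype.card_fin] at h1
    exact Finset.mem_range.mpr (Nat.lt_succ_of_le ((Nat.sub_le _ _).trans h1))
  change ∑ K ∈ 𝒦, ((q ^ n)⁻¹) ^ (χ K) ≤ _
  rw [← Finset.sum_fiberwise_of_maps_to hmaps, Finset.sum_range_succ']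
  have hterm : ∀ c, ∑ K ∈ 𝒦 with χ K = c, ((q ^ n)⁻¹) ^ (χ K) =
      (𝒦.filter (χ · = c)).card * ((q ^ n)⁻¹) ^ c := fun c => by
    rw [Finset.sum_congr rfl fun K hK => by rw [(Finset.mem_filter.mp hK).2], Finset.sum_const,
      nsmul_eq_mul]
  simp only [hterm]
  have hzero : (𝒦.filter (χ · = 0)).card ≤ 1 := by
    refine Finset.card_le_one_iff_subset_singleton.mpr ⟨⊥, fun K hK => ?_⟩
    rw [Finset.mem_filter] at hK
    exact Finset.mem_singleton.mpr (eq_bot_of_finrank_le hg hper (Nat.sub_eq_zero_iff_le.mp hK.2)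
      (h𝒦 K hK.1).2)
  have hsucc : ∀ c, ((𝒦.filter (χ · = c + 1)).card : ℝ) * ((q ^ n)⁻¹) ^ (c + 1) ≤
      q ^ (r * ℓ * (r + 1)) / q ^ n := fun c => by
    have hcard : (𝒦.filter (χ · = c + 1)).card ≤ Fintype.card F ^ (r * ℓ * (c + 1 + r)) := by
      refine card_consistent_le hg _ _ fun K hK => ?_
      rw [Finset.mem_filter] at hK
      exact ⟨(h𝒦 K hK.1).1, Nat.sub_le_iff_le_add.mp hK.2.le⟩
    rw [← Nat.cast_le (α := ℝ), Nat.cast_pow] at hcard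
    have hqn : 0 < q ^ n := by positivity
    calc _ ≤ q ^ (r * ℓ * (c + 1 + r)) * ((q ^ n)⁻¹) ^ (c + 1) := by gcongr
      _ = q ^ (r * ℓ * (r + 1)) / q ^ n * (q ^ (r * ℓ * c) / q ^ (n * c)) := by
        rw [inv_pow, ← pow_mul, ← div_eq_mul_inv, div_mul_div_comm, ← pow_add, ← pow_add]
        ring_nf
      _ ≤ q ^ (r * ℓ * (r + 1)) / q ^ n * 1 := by
        gcongr
        exact div_le_one_of_le₀ (pow_le_pow_right₀ hq (Nat.mul_le_mul_right _ hn)) (by positivity)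
      _ = _ := mul_one _
  have hsum := Finset.sum_le_card_nsmul (Finset.range (r * ℓ)) _ _ fun c _ => hsucc c
  rw [Finset.card_range, nsmul_eq_mul] at hsum
  have hzero' : ((𝒦.filter (χ · = 0)).card : ℝ) ≤ 1 := by exact_mod_cast hzero
  rw [pow_zero, mul_one]
  linarith

theorem prod_card_isTransport_le [DecidableEq ι] (hn : r * ℓ ≤ n)
    {T : Fin r × Fin ℓ → Fin n → F} {K : Submodule F (Fin r × Fin ℓ → F)}
    (hTK : LinearMap.ker (Fintype.linearCombination F T) = K) (hK : Consistent g K) :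
    (∏ j, (Nat.card {x : GL (Fin n) F // IsTransport g T j x} : ℝ)) *
      (((Fintype.card F : ℝ) ^ n) ^ (r * ℓ - ∑ j, finrank F (edgeSpace g K j)) *
        (1 - (r * ℓ : ℕ) * ((Fintype.card F : ℝ) ^ (r * ℓ) / (Fintype.card F : ℝ) ^ n))) ≤
      (Nat.card (GL (Fin n) F) : ℝ) ^ Fintype.card ι := by
  subst hTK
  set K := LinearMap.ker (Fintype.linearCombination F T)
  set q := (Fintype.card F : ℝ) with hqdef
  have hq : 1 ≤ q := Nat.one_le_cast.mpr Fintype.card_pos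
  have hqn : 1 ≤ q ^ n := one_le_pow₀ hq
  set ε := q ^ (r * ℓ) / q ^ n
  have hε0 : 0 ≤ ε := by positivity
  have hε1 : ε ≤ 1 := div_le_one_of_le₀ (pow_le_pow_right₀ hq hn) (by positivity)
  set d : ι → ℕ := fun j => Fintype.card {e : Fin r × Fin ℓ // (g e.2).1 = j} -
    finrank F (edgeSpace g K j)
  have hcard : ∑ j, Fintype.card {e : Fin r × Fin ℓ // (g e.2).1 = j} = r * ℓ := by
    rw [← Fintype.card_sigma, Fintype.card_congr (Equiv.sigmaFiberEquiv _), Fintype.card_prod,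
      Fintype.card_fin, Fintype.card_fin]
  have hd_le : ∑ j, d j ≤ r * ℓ := by
    rw [← hcard]
    exact Finset.sum_le_sum fun j _ => Nat.sub_le _ _
  have hd_ge : r * ℓ - ∑ j, finrank F (edgeSpace g K j) ≤ ∑ j, d j := by
    rw [Nat.sub_le_iff_le_add, ← hcard, ← Finset.sum_add_distrib]
    exact Finset.sum_le_sum fun j _ => le_tsub_add
  have hbern : 1 - (r * ℓ : ℕ) * ε ≤ (1 - ε) ^ (∑ j, d j) := by
    have h1 := one_add_mul_le_pow (a := -ε) (by linarith) (r * ℓ)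
    calc 1 - (r * ℓ : ℕ) * ε = 1 + (r * ℓ : ℕ) * (-ε) := by ring
      _ ≤ (1 + -ε) ^ (r * ℓ) := h1
      _ = (1 - ε) ^ (r * ℓ) := by rw [sub_eq_add_neg]
      _ ≤ _ := pow_le_pow_of_le_one (by linarith) (by linarith) hd_le
  have hj : ∀ j, (Nat.card {x : GL (Fin n) F // IsTransport g T j x} : ℝ) *
      (q ^ n * (1 - ε)) ^ d j ≤ Nat.card (GL (Fin n) F) := fun j => by
    have hdj : d j ≤ r * ℓ :=
      (Finset.single_le_sum (fun _ _ => Nat.zero_le _) (Finset.mem_univ j)).trans hd_le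
    have h1 : (Nat.card {x : GL (Fin n) F // IsTransport g T j x} : ℝ) *
        ∏ i : Fin (d j), (q ^ n - q ^ (i : ℕ)) ≤ Nat.card (GL (Fin n) F) := by
      have h2 := card_isTransport_mul_le hK j
      rw [← Nat.cast_le (α := ℝ), Nat.cast_mul, Nat.cast_prod] at h2
      refine (congrArg _ (Finset.prod_congr rfl fun i _ => ?_)).trans_le h2
      rw [Nat.cast_sub (Nat.pow_le_pow_right Fintype.card_pos (i.2.le.trans (hdj.trans hn))),
        Nat.cast_pow, Nat.cast_pow]
    exact (mul_le_mul_of_nonneg_left (pow_mul_one_sub_le_prod hq hdj hn)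
      (Nat.cast_nonneg _)).trans h1
  calc _ ≤ (∏ j, (Nat.card {x : GL (Fin n) F // IsTransport g T j x} : ℝ)) *
        ((q ^ n) ^ (∑ j, d j) * (1 - ε) ^ (∑ j, d j)) := by
        refine mul_le_mul_of_nonneg_left ?_ (Finset.prod_nonneg fun _ _ => Nat.cast_nonneg _)
        have h1 : 0 ≤ (1 - ε) ^ (∑ j, d j) := pow_nonneg (by linarith) _
        exact (mul_le_mul_of_nonneg_left hbern (by positivity)).trans
          (mul_le_mul_of_nonneg_right (pow_le_pow_right₀ hqn hd_ge) h1)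
    _ = ∏ j, (Nat.card {x : GL (Fin n) F // IsTransport g T j x} : ℝ) *
        (q ^ n * (1 - ε)) ^ d j := by
        rw [← mul_pow, ← Finset.prod_pow_eq_pow_sum, Finset.prod_mul_distrib]
    _ ≤ ∏ _j : ι, (Nat.card (GL (Fin n) F) : ℝ) := Finset.prod_le_prod (fun j _ => mul_nonneg
        (Nat.cast_nonneg _) (pow_nonneg (mul_nonneg (by positivity) (by linarith)) _)) fun j _ => hj j
    _ = _ := by rw [Finset.prod_const, Finset.card_univ]

variable (g r n F) in
/-- Placements of the vertices and matrices for the labels such that the matrices move along all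
edges and the vectors at the base vertices are linearly independent. -/
def ClosedPlacement : Type _ :=
  {p : (Fin r × Fin ℓ → Fin n → F) × (ι → GL (Fin n) F) //
    (∀ j, IsTransport g p.1 j (p.2 j)) ∧ LinearIndependent F fun i => p.1 (i, 0)}

theorem card_closedPlacement_le_sum (hg : CyclicallyReduced g) (hper : Aperiodic g)
    (hn : r * ℓ ≤ n)
    (hδ : (r * ℓ : ℕ) * ((Fintype.card F : ℝ) ^ (r * ℓ) / (Fintype.card F : ℝ) ^ n) < 1) :
    (Nat.card (ClosedPlacement r n F g) : ℝ) *
      (1 - (r * ℓ : ℕ) * ((Fintype.card F : ℝ) ^ (r * ℓ) / (Fintype.card F : ℝ) ^ n)) ≤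
      (Nat.card (GL (Fin n) F) : ℝ) ^ Fintype.card ι *
        (1 + (r * ℓ : ℕ) *
          ((Fintype.card F : ℝ) ^ (r * ℓ * (r + 1)) / (Fintype.card F : ℝ) ^ n)) := by
  classical
  have hsum := fun 𝒦 h𝒦 => sum_consistent_le (F := F) (r := r) hg hper hn 𝒦 h𝒦
  set q := (Fintype.card F : ℝ) with hqdef
  have hq : 1 ≤ q := Nat.one_le_cast.mpr Fintype.card_pos
  set δ := (r * ℓ : ℕ) * (q ^ (r * ℓ) / q ^ n)
  set rel : (Fin r × Fin ℓ → Fin n → F) → Submodule F (Fin r × Fin ℓ → F) :=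
    fun T => LinearMap.ker (Fintype.linearCombination F T)
  have : Fintype (Submodule F (Fin r × Fin ℓ → F)) := Fintype.ofFinite _
  let 𝒦 : Finset (Submodule F (Fin r × Fin ℓ → F)) :=
    {K | Consistent g K ∧ ∀ z ∈ K, (∀ p, p.2 ≠ 0 → z p = 0) → z = 0}
  let 𝒯 : Finset (Fin r × Fin ℓ → Fin n → F) := {T | rel T ∈ 𝒦}
  have hcount : Nat.card (ClosedPlacement r n F g) ≤
      ∑ T ∈ 𝒯, ∏ j, Nat.card {x : GL (Fin n) F // IsTransport g T j x} := by
    have hmem : ∀ p : ClosedPlacement r n F g, p.1.1 ∈ 𝒯 := fun p => by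
      refine Finset.mem_filter.mpr ⟨Finset.mem_univ _, Finset.mem_filter.mpr ⟨Finset.mem_univ _,
        consistent_of_isTransport p.2.1, fun z hz hz0 => ?_⟩⟩
      have hlin : ∑ i, z (i, 0) • p.1.1 (i, 0) = 0 := by
        have h1 : ∑ e, z e • p.1.1 e = 0 := hz
        rw [Fintype.sum_prod_type] at h1
        rw [← h1]
        refine Finset.sum_congr rfl fun i _ => ?_
        rw [Finset.sum_eq_single 0]
        · intro s _ hs
          rw [hz0 (i, s) hs, zero_smul]
        · simp
      have h0 := Fintype.linearIndependent_iff.mp p.2.2 _ hlin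
      ext ⟨i, s⟩
      by_cases hs : s = 0
      · subst hs
        exact h0 i
      · exact hz0 (i, s) hs
    have hinj := Nat.card_le_card_of_injective
      (fun p : ClosedPlacement r n F g =>
        (⟨⟨p.1.1, hmem p⟩, fun j => ⟨p.1.2 j, p.2.1 j⟩⟩ :
          Σ T : 𝒯, ∀ j, {x : GL (Fin n) F // IsTransport g T.1 j x})) (by
        rintro ⟨⟨T, x⟩, hp⟩ ⟨⟨T', x'⟩, hp'⟩ h
        simp only [Sigma.mk.injEq, Subtype.mk.injEq] at h
        obtain ⟨rfl, h⟩ := h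
        refine Subtype.ext (Prod.ext rfl (funext fun j => ?_))
        exact congrArg Subtype.val (congrFun (eq_of_heq h) j))
    rw [Nat.card_sigma] at hinj
    simp only [Nat.card_pi] at hinj
    rwa [Finset.sum_coe_sort 𝒯
      (fun T => ∏ j, Nat.card {x : GL (Fin n) F // IsTransport g T j x})] at hinj
  set G := (Nat.card (GL (Fin n) F) : ℝ) ^ Fintype.card ι
  set e : Submodule F (Fin r × Fin ℓ → F) → ℕ := fun K => ∑ j, finrank F (edgeSpace g K j)
  have hfiber : ∀ K ∈ 𝒦, (∑ T ∈ 𝒯 with rel T = K,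
      ∏ j, (Nat.card {x : GL (Fin n) F // IsTransport g T j x} : ℝ)) * (1 - δ) ≤
      G * ((q ^ n)⁻¹) ^ (finrank F K - e K) := fun K hK => by
    have hKc := (Finset.mem_filter.mp hK).2.1
    have hrank := Submodule.finrank_le K
    simp only [Module.finrank_fintype_fun_eq_card, Fintype.card_prod, Fintype.card_fin] at hrank
    have heK : e K ≤ finrank F K := sum_finrank_edgeSpace_le hg K
    have hcard : ((𝒯.filter (rel · = K)).card : ℝ) ≤ (q ^ n) ^ (r * ℓ - finrank F K) := by
      have h1 := card_relations_le (n := n) K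
      have h2 : (𝒯.filter (rel · = K)).card ≤ Nat.card {T : Fin r × Fin ℓ → Fin n → F //
          K ≤ LinearMap.ker (Fintype.linearCombination F T)} := by
        rw [Nat.card_eq_fintype_card, Fintype.card_subtype]
        exact Finset.card_le_card fun T hT =>
          Finset.mem_filter.mpr ⟨Finset.mem_univ _, (Finset.mem_filter.mp hT).2.ge⟩
      have h3 := h2.trans h1
      rwa [← Nat.cast_le (α := ℝ), Nat.cast_pow, Fintype.card_prod, Fintype.card_fin,
        Fintype.card_fin, pow_mul] at h3
    have hqn : 0 < q ^ n := by positivity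
    have hterm : ∀ T ∈ 𝒯.filter (rel · = K),
        (∏ j, (Nat.card {x : GL (Fin n) F // IsTransport g T j x} : ℝ)) * (1 - δ) ≤
          G * ((q ^ n)⁻¹) ^ (r * ℓ - e K) := fun T hT => by
      have h1 := prod_card_isTransport_le hn (Finset.mem_filter.mp hT).2 hKc
      rw [inv_pow, ← div_eq_mul_inv, le_div_iff₀ (by positivity), mul_assoc, mul_comm (1 - δ)]
      exact h1
    rw [Finset.sum_mul]
    refine (Finset.sum_le_card_nsmul _ _ _ hterm).trans ?_
    rw [nsmul_eq_mul]
    refine (mul_le_mul_of_nonneg_right hcard (by positivity)).trans_eq ?_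
    rw [← tsub_add_tsub_cancel hrank heK, pow_add, inv_pow, inv_pow]
    field_simp
  calc (Nat.card (ClosedPlacement r n F g) : ℝ) * (1 - δ)
      ≤ (∑ T ∈ 𝒯, ∏ j, (Nat.card {x : GL (Fin n) F // IsTransport g T j x} : ℝ)) * (1 - δ) := by
        refine mul_le_mul_of_nonneg_right ?_ (by linarith)
        rw [← Nat.cast_le (α := ℝ)] at hcount
        simpa only [Nat.cast_sum, Nat.cast_prod] using hcount
    _ = ∑ K ∈ 𝒦, (∑ T ∈ 𝒯 with rel T = K,
          ∏ j, (Nat.card {x : GL (Fin n) F // IsTransport g T j x} : ℝ)) * (1 - δ) := by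
        rw [← Finset.sum_fiberwise_of_maps_to (s := 𝒯) (t := 𝒦) (g := rel)
          (fun T hT => (Finset.mem_filter.mp hT).2), Finset.sum_mul]
    _ ≤ ∑ K ∈ 𝒦, G * ((q ^ n)⁻¹) ^ (finrank F K - e K) := Finset.sum_le_sum hfiber
    _ = G * ∑ K ∈ 𝒦, ((q ^ n)⁻¹) ^ (finrank F K - e K) := (Finset.mul_sum _ _ _).symm
    _ ≤ _ := mul_le_mul_of_nonneg_left (hsum 𝒦 fun K hK => (Finset.mem_filter.mp hK).2)
        (by positivity)

theorem natCast_mul_pow_div_le {q : ℝ} (hq : 2 ≤ q) (m a n : ℕ) {x : ℝ}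
    (hx : (m : ℝ) + a - n ≤ x) : m * (q ^ a / q ^ n) ≤ q ^ x := by
  have hq0 : 0 < q := by linarith
  have hm : (m : ℝ) ≤ q ^ m := by
    have h1 : (m : ℝ) ≤ 2 ^ m := by exact_mod_cast (Nat.lt_two_pow_self (n := m)).le
    exact h1.trans (pow_le_pow_left₀ (by norm_num) hq m)
  calc m * (q ^ a / q ^ n) ≤ q ^ m * (q ^ a / q ^ n) := by gcongr
    _ = q ^ ((m : ℝ) + a - n) := by
      rw [Real.rpow_sub hq0, Real.rpow_add hq0, Real.rpow_natCast, Real.rpow_natCast,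
        Real.rpow_natCast, mul_div_assoc]
    _ ≤ q ^ x := Real.rpow_le_rpow_of_exponent_le (by linarith) hx

theorem card_closedPlacement_le (hg : CyclicallyReduced g) (hper : Aperiodic g)
    (hn : 4 * (ℓ * r ^ 2) < n) :
    (Nat.card (ClosedPlacement r n F g) : ℝ) ≤
      (Nat.card (GL (Fin n) F) : ℝ) ^ Fintype.card ι *
        (1 + 5 * (Fintype.card F : ℝ) ^ (2 * (ℓ : ℝ) * r - (n : ℝ) / 2)) := by
  have hq : 2 ≤ (Fintype.card F : ℝ) := by exact_mod_cast Fintype.one_lt_card (α := F)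
  have hm : r * ℓ ≤ ℓ * r ^ 2 :=
    (mul_comm r ℓ).trans_le (Nat.mul_le_mul_left _ (Nat.le_self_pow two_ne_zero r))
  have hn' : 4 * ((ℓ : ℝ) * r ^ 2) < n := by exact_mod_cast hn
  have hm' : (r : ℝ) * ℓ ≤ ℓ * r ^ 2 := by exact_mod_cast hm
  have hδ₂ : (r * ℓ : ℕ) * ((Fintype.card F : ℝ) ^ (r * ℓ) / (Fintype.card F : ℝ) ^ n) ≤ 1 / 2 := by
    have h1 : (2 * (r * ℓ) + 1 : ℕ) ≤ n := by omega
    have h2 : 2 * ((r : ℝ) * ℓ) + 1 ≤ n := by exact_mod_cast h1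
    refine (natCast_mul_pow_div_le hq _ _ _ (x := -1) (by push_cast; linarith)).trans ?_
    rw [Real.rpow_neg_one, one_div]
    exact inv_anti₀ (by norm_num) hq
  have hδQ := natCast_mul_pow_div_le hq (r * ℓ) (r * ℓ) n
    (x := 2 * (ℓ : ℝ) * r - (n : ℝ) / 2) (by push_cast; nlinarith)
  have hXQ := natCast_mul_pow_div_le hq (r * ℓ) (r * ℓ * (r + 1)) n
    (x := 2 * (ℓ : ℝ) * r - (n : ℝ) / 2) (by push_cast; nlinarith)
  have hQ1 : (Fintype.card F : ℝ) ^ (2 * (ℓ : ℝ) * r - (n : ℝ) / 2) ≤ 1 :=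
    Real.rpow_le_one_of_one_le_of_nonpos (by linarith) (by nlinarith)
  have hmain := card_closedPlacement_le_sum (F := F) hg hper (by omega) (hδ₂.trans_lt (by norm_num))
  set Q := (Fintype.card F : ℝ) ^ (2 * (ℓ : ℝ) * r - (n : ℝ) / 2)
  set δ := (r * ℓ : ℕ) * ((Fintype.card F : ℝ) ^ (r * ℓ) / (Fintype.card F : ℝ) ^ n)
  set G := (Nat.card (GL (Fin n) F) : ℝ) ^ Fintype.card ι
  have hδ0 : 0 ≤ δ := by positivity
  have hQ0 : 0 ≤ Q := by positivity
  have hG : 0 ≤ G := by positivity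
  refine le_of_mul_le_mul_right (hmain.trans ?_) (show 0 < 1 - δ by linarith)
  rw [mul_assoc G (1 + 5 * Q)]
  refine mul_le_mul_of_nonneg_left ?_ hG
  nlinarith [mul_nonneg hQ0 (sub_nonneg.mpr hδ₂)]

end Counting

section Words

variable {α : Type*} {L : List (α × Bool)} [NeZero L.length]

theorem val_add_one_eq_of_add_one_eq_zero {ℓ : ℕ} [NeZero ℓ] {e : Fin ℓ} (he : e + 1 = 0) :
    e.val + 1 = ℓ := by
  have h1 := congrArg Fin.val he
  have h2 := e.2
  rw [Fin.val_add, Fin.val_zero, Fin.coe_ofNat_eq_mod, Nat.add_mod_mod] at h1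
  exact (Nat.le_of_dvd (Nat.succ_pos _) (Nat.dvd_of_mod_eq_zero h1)).antisymm' h2

theorem cyclicallyReduced_get (hL : FreeGroup.IsCyclicallyReduced L) :
    CyclicallyReduced L.get := by
  intro e
  obtain ⟨hred, hends⟩ := hL
  have hpos := e.pos
  by_cases he : e + 1 = 0
  · have hlast := val_add_one_eq_of_add_one_eq_zero he
    rw [he]
    refine hends _ ?_ _ ?_
    · rw [Option.mem_def, List.getLast?_eq_getElem?, List.get_eq_getElem, List.getElem?_eq_getElem
        (by omega)]
      congr 2
      omega
    · rw [Option.mem_def, List.head?_eq_getElem?, List.get_eq_getElem,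
        List.getElem?_eq_getElem hpos]
      rfl
  · have hval := Fin.val_add_one_of_ne_zero he
    have h1 := List.isChain_iff_getElem.mp hred e.val (hval ▸ (e + 1).2)
    simpa only [List.get_eq_getElem, hval] using h1

theorem mk_map_range_mul {G : ℕ → α × Bool} {d : ℕ} (hG : ∀ i, G (i + d) = G i) (m : ℕ) :
    FreeGroup.mk ((List.range (m * d)).map G) = FreeGroup.mk ((List.range d).map G) ^ m := by
  have hm : ∀ m i, G (m * d + i) = G i := fun m => by
    induction m with
    | zero => simp
    | succ m ih =>
      intro i
      rw [Nat.succ_mul, add_right_comm, hG, ih]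
  induction m with
  | zero => simp [FreeGroup.one_eq_mk]
  | succ m ih =>
    rw [Nat.succ_mul, List.range_add, List.map_append, ← FreeGroup.mul_mk, ih, pow_succ,
      List.map_map]
    congr 3
    exact funext (hm m)

theorem aperiodic_get (hL : ¬ ∃ (u : FreeGroup α) (m : ℕ), 2 ≤ m ∧ FreeGroup.mk L = u ^ m) :
    Aperiodic L.get := by
  intro t ht
  by_contra ht0
  have htpos : 0 < t.val := Nat.pos_of_ne_zero fun h => ht0 (Fin.ext h)
  obtain ⟨d, hd⟩ : ∃ d, Nat.gcd t.val L.length = d := ⟨_, rfl⟩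
  have hdlt : d < L.length := hd ▸ (Nat.gcd_le_left _ htpos).trans_lt t.2
  obtain ⟨a, -, ha⟩ := Nat.exists_mul_mod_eq_gcd (hd ▸ hdlt)
  set G : ℕ → α × Bool := fun i => L.get (Fin.ofNat L.length i)
  have hGt : ∀ i, G (i + t.val) = G i := fun i => by
    refine (congrArg L.get (Fin.ext ?_)).trans (ht (Fin.ofNat L.length i))
    simp [Fin.val_add, Fin.ofNat]
  have hGta : ∀ a i, G (i + t.val * a) = G i := fun a => by
    induction a with
    | zero => simp
    | succ a ih => exact fun i => by rw [Nat.mul_succ, ← add_assoc, hGt, ih]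
  have hGd : ∀ i, G (i + d) = G i := fun i => by
    rw [← hGta a i]
    refine congrArg L.get (Fin.ext ?_)
    change (i + d) % L.length = (i + t.val * a) % L.length
    rw [← Nat.add_mod_mod i (t.val * a), ha, hd]
  obtain ⟨m, hm⟩ : d ∣ L.length := hd ▸ Nat.gcd_dvd_right t.val L.length
  have hLG : L = (List.range (m * d)).map G := by
    rw [mul_comm m d, ← hm]
    refine List.ext_getElem (by simp) fun i h1 h2 => ?_
    simp [G, Fin.ofNat, Nat.mod_eq_of_lt (h1)]
  refine hL ⟨_, m, ?_, (congrArg FreeGroup.mk hLG).trans (mk_map_range_mul hGd m)⟩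
  by_contra! hm2
  have : d * m ≤ d * 1 := Nat.mul_le_mul_left _ (by omega)
  omega

end Words

section Frames

open Matrix

variable {r n : ℕ} {F : Type*} [Field F] {α : Type*}

variable (r n F) in
/-- Tuples of matrices together with a linearly independent `r`-tuple of vectors fixed by the value
of the word `w`. -/
def FixedFrame (w : FreeGroup α) : Type _ :=
  {p : (α → GL (Fin n) F) × (Fin r → Fin n → F) //
    LinearIndependent F p.2 ∧ ∀ i, (FreeGroup.lift p.1 w).1 *ᵥ p.2 i = p.2 i}

theorem card_fixedFrame_conj_le [Finite α] [Fintype F] (c u : FreeGroup α) :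
    Nat.card (FixedFrame r n F (c * u * c⁻¹)) ≤ Nat.card (FixedFrame r n F u) := by
  have : Finite (FixedFrame r n F u) := Subtype.finite
  refine Nat.card_le_card_of_injective (fun p => ⟨(p.1.1, fun i =>
    (FreeGroup.lift p.1.1 c⁻¹).1 *ᵥ p.1.2 i), linearIndependent_mulVec p.2.1 _, fun i => ?_⟩) ?_
  · obtain ⟨⟨x, v⟩, hp⟩ := p
    have h1 := congrArg ((FreeGroup.lift x c⁻¹).1 *ᵥ ·) (hp.2 i)
    simp only [Matrix.mulVec_mulVec, ← Units.val_mul, ← map_mul] at h1 ⊢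
    rwa [mul_assoc c, inv_mul_cancel_left] at h1
  · rintro ⟨⟨x, v⟩, hp⟩ ⟨⟨x', v'⟩, hp'⟩ h
    have h1 := congrArg Subtype.val h
    simp only [Prod.mk.injEq] at h1
    obtain ⟨rfl, h1⟩ := h1
    refine Subtype.ext (Prod.ext rfl (funext fun i => ?_))
    exact generalLinearGroup_mulVec_injective _ (congrFun h1 i)

theorem lift_conj {G : Type*} [Group G] (h : G) (x : α → G) (w : FreeGroup α) :
    FreeGroup.lift (fun a => h * x a * h⁻¹) w = h * FreeGroup.lift x w * h⁻¹ := by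
  have h1 : FreeGroup.lift (fun a => h * x a * h⁻¹) =
      (MulAut.conj h).toMonoidHom.comp (FreeGroup.lift x) :=
    FreeGroup.ext_hom _ _ fun a => by simp
  rw [h1]
  simp

theorem card_fixing_mul_le [Finite α] [Fintype F] (w : FreeGroup α) {v : Fin r → Fin n → F}
    (hv : LinearIndependent F v) :
    Nat.card {x : α → GL (Fin n) F // ∀ i, (FreeGroup.lift x w).1 *ᵥ v i = v i} *
      ∏ i : Fin r, (Fintype.card F ^ n - Fintype.card F ^ (i : ℕ)) ≤
      Nat.card (FixedFrame r n F w) := by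
  have hrn : r ≤ finrank F (Fin n → F) := by simpa using hv.fintype_card_le_finrank
  have hcard := card_linearIndependent (K := F) (V := Fin n → F) hrn
  rw [Module.finrank_fin_fun] at hcard
  rw [← hcard, ← Nat.card_prod]
  choose h hh using fun y : {s : Fin r → Fin n → F // LinearIndependent F s} =>
    exists_generalLinearGroup_mulVec_eq hv y.2
  have : Finite (FixedFrame r n F w) := Subtype.finite
  refine Nat.card_le_card_of_injective (fun p => ⟨(fun a => h p.2 * p.1.1 a * (h p.2)⁻¹, p.2.1),
    p.2.2, fun i => ?_⟩) ?_
  · simp only [lift_conj]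
    rw [← hh p.2 i, Matrix.mulVec_mulVec, ← Units.val_mul, inv_mul_cancel_right, Units.val_mul,
      ← Matrix.mulVec_mulVec, p.1.2 i]
  · rintro ⟨x, y⟩ ⟨x', y'⟩ hxy
    have h1 := congrArg Subtype.val hxy
    simp only [Prod.mk.injEq] at h1
    obtain ⟨h1, h2⟩ := h1
    obtain rfl := Subtype.ext h2
    refine Prod.ext (Subtype.ext (funext fun a => ?_)) rfl
    simpa using congrFun h1 a

/-- The positions of the vectors `v` while the letters of `L` are applied from the right. -/
def trajectory (L : List (α × Bool)) (x : α → GL (Fin n) F) (v : Fin r → Fin n → F)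
    (p : Fin r × Fin L.length) : Fin n → F :=
  (FreeGroup.lift x (FreeGroup.mk (L.drop p.2))).1 *ᵥ v p.1

variable {L : List (α × Bool)} [NeZero L.length]

theorem trajectory_zero {x : α → GL (Fin n) F} {v : Fin r → Fin n → F}
    (hv : ∀ i, (FreeGroup.lift x (FreeGroup.mk L)).1 *ᵥ v i = v i) (i : Fin r) :
    trajectory L x v (i, 0) = v i := by
  simpa [trajectory] using hv i

theorem trajectory_succ {x : α → GL (Fin n) F} {v : Fin r → Fin n → F}
    (hv : ∀ i, (FreeGroup.lift x (FreeGroup.mk L)).1 *ᵥ v i = v i) (i : Fin r) (s : Fin L.length) :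
    trajectory L x v (i, s) =
      (FreeGroup.lift x (FreeGroup.mk [L.get s])).1 *ᵥ trajectory L x v (i, s + 1) := by
  by_cases hs : s + 1 = 0
  · rw [hs, trajectory_zero hv, trajectory, List.drop_eq_getElem_cons s.2,
      val_add_one_eq_of_add_one_eq_zero hs, List.drop_length]
    rfl
  · rw [trajectory, trajectory, Matrix.mulVec_mulVec, ← Units.val_mul, ← map_mul, FreeGroup.mul_mk,
      Fin.val_add_one_of_ne_zero hs, List.drop_eq_getElem_cons s.2]
    rfl

theorem isTransport_trajectory {x : α → GL (Fin n) F} {v : Fin r → Fin n → F}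
    (hv : ∀ i, (FreeGroup.lift x (FreeGroup.mk L)).1 *ᵥ v i = v i) (j : α) :
    IsTransport L.get (trajectory L x v) j (x j) := by
  rintro ⟨⟨i, s⟩, hj⟩
  have h1 := trajectory_succ hv i s
  obtain ⟨b, hs⟩ : ∃ b, L.get s = (j, b) := ⟨(L.get s).2, Prod.ext hj rfl⟩
  cases b
  · simp only [hs, FreeGroup.lift_mk, List.map_cons, List.map_nil, List.prod_cons, List.prod_nil,
      mul_one, cond_false, endpoint, if_true] at h1 ⊢
    simp [h1, Matrix.mulVec_mulVec]
  · simp only [hs, FreeGroup.lift_mk, List.map_cons, List.map_nil, List.prod_cons, List.prod_nil,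
      mul_one, cond_true, endpoint, if_true] at h1 ⊢
    simp [h1]

theorem card_fixedFrame_mk_le [Finite α] [Fintype F] :
    Nat.card (FixedFrame r n F (FreeGroup.mk L)) ≤ Nat.card (ClosedPlacement r n F L.get) := by
  have : Finite (ClosedPlacement r n F L.get) := Subtype.finite
  refine Nat.card_le_card_of_injective (fun p => ⟨(trajectory L p.1.1 p.1.2, p.1.1),
    isTransport_trajectory p.2.2, ?_⟩) ?_
  · simpa only [trajectory_zero p.2.2] using p.2.1
  · rintro ⟨⟨x, v⟩, hp⟩ ⟨⟨x', v'⟩, hp'⟩ h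
    have h1 := congrArg Subtype.val h
    simp only [Prod.mk.injEq] at h1
    obtain ⟨h1, rfl⟩ := h1
    refine Subtype.ext (Prod.ext rfl (funext fun i => ?_))
    simpa only [trajectory_zero hp.2, trajectory_zero hp'.2] using congrFun h1 (i, 0)

end Frames

theorem card_fixedFrame_le {F : Type*} [Field F] [Fintype F] {n k r : ℕ} {w : FreeGroup (Fin k)}
    (hw : w ≠ 1) (hpow : ¬ ∃ (u : FreeGroup (Fin k)) (m : ℕ), 2 ≤ m ∧ w = u ^ m)
    (hn : 4 * (w.norm * r ^ 2) < n) :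
    (Nat.card (FixedFrame r n F w) : ℝ) ≤ (Nat.card (GL (Fin n) F) : ℝ) ^ k *
      (1 + 5 * (Fintype.card F : ℝ) ^ (2 * (w.norm : ℝ) * r - (n : ℝ) / 2)) := by
  have hconj := FreeGroup.reduceCyclically.conj_conjugator_reduceCyclically w.toWord
  have hcyc := FreeGroup.reduceCyclically.isCyclicallyReduced w.isReduced_toWord
  set L := FreeGroup.reduceCyclically w.toWord
  set c := FreeGroup.mk (FreeGroup.reduceCyclically.conjugator w.toWord)
  have hwc : w = c * FreeGroup.mk L * c⁻¹ := by
    rw [FreeGroup.inv_mk, FreeGroup.mul_mk, FreeGroup.mul_mk, hconj, FreeGroup.mk_toWord]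
  have hlen : L.length ≤ w.norm := by
    have h1 := congrArg List.length hconj
    simp only [List.length_append] at h1
    rw [FreeGroup.norm]
    omega
  have : NeZero L.length := ⟨fun h0 => hw (by
    rw [hwc, List.eq_nil_of_length_eq_zero h0, ← FreeGroup.one_eq_mk, mul_one, mul_inv_cancel])⟩
  have hper : Aperiodic L.get := aperiodic_get fun ⟨u, m, hm, h⟩ =>
    hpow ⟨c * u * c⁻¹, m, hm, by rw [hwc, h, conj_pow]⟩
  have hcount := card_closedPlacement_le (r := r) (n := n) (F := F) (cyclicallyReduced_get hcyc)
    hper ((Nat.mul_le_mul_left _ (Nat.mul_le_mul_right _ hlen)).trans_lt hn)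
  have hle := (hwc ▸ card_fixedFrame_conj_le c (FreeGroup.mk L)).trans
    (card_fixedFrame_mk_le (F := F) (r := r) (n := n) (L := L))
  refine (Nat.cast_le.mpr hle).trans (hcount.trans ?_)
  have hq : 1 ≤ (Fintype.card F : ℝ) := Nat.one_le_cast.mpr Fintype.card_pos
  rw [Fintype.card_fin]
  gcongr

/-- **The probability that a joint trajectory of `r` vectors closes**
(Lemma 8.2, linear case). There is a constant `C > 0` such that for every finite
field `F_q`, every nontrivial word `w ∈ F_k` of reduced length `ℓ` with
`ℓ·r² < n/4` that is not a proper power, and all linearly independent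
`v_1, …, v_r ∈ F_q^n`: for uniformly random `x_1, …, x_k ∈ GL_n(q)`, the
probability that `w(x_1, …, x_k)·v_i = v_i` for all `i` is at most
`(1/N)·(1 + C·q^{2ℓr - n/2})`, where `N = ∏_{i=0}^{r-1} (q^n - q^i)`. -/
theorem stmt15 :
    ∃ C : ℝ, 0 < C ∧
      ∀ (F : Type) [Field F] [Fintype F] (n k r : ℕ), 0 < r →
        ∀ w : FreeGroup (Fin k), w ≠ 1 →
        (¬ ∃ (u : FreeGroup (Fin k)) (m : ℕ), 2 ≤ m ∧ w = u ^ m) →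
        (w.norm : ℝ) * r ^ 2 < (n : ℝ) / 4 →
        ∀ v : Fin r → Fin n → F, LinearIndependent F v →
          (Nat.card {x : Fin k → GL (Fin n) F //
              ∀ i : Fin r,
                ((FreeGroup.lift x w : GL (Fin n) F) :
                  Matrix (Fin n) (Fin n) F).mulVec (v i) = v i} : ℝ) /
              (Nat.card (GL (Fin n) F) : ℝ) ^ k ≤
            (1 / (∏ i : Fin r, ((Fintype.card F : ℝ) ^ n - (Fintype.card F : ℝ) ^ (i : ℕ)))) *
              (1 + C * (Fintype.card F : ℝ) ^
                (2 * (w.norm : ℝ) * r - (n : ℝ) / 2)) := by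
  refine ⟨5, by norm_num, fun F _ _ n k r _ w hw hpow hn v hv => ?_⟩
  have hn' : 4 * (w.norm * r ^ 2) < n := by
    have h1 : 4 * ((w.norm : ℝ) * r ^ 2) < n := by linarith
    exact_mod_cast h1
  have hframes := card_fixedFrame_le (F := F) hw hpow hn'
  have hfix := card_fixing_mul_le w hv
  have hrn : r ≤ n := by simpa using hv.fintype_card_le_finrank
  have hN : ((∏ i : Fin r, (Fintype.card F ^ n - Fintype.card F ^ (i : ℕ)) : ℕ) : ℝ) =
      ∏ i : Fin r, ((Fintype.card F : ℝ) ^ n - (Fintype.card F : ℝ) ^ (i : ℕ)) := by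
    rw [Nat.cast_prod]
    refine Finset.prod_congr rfl fun i _ => ?_
    rw [Nat.cast_sub (Nat.pow_le_pow_right Fintype.card_pos (i.2.le.trans hrn)), Nat.cast_pow,
      Nat.cast_pow]
  have hNpos : 0 < ∏ i : Fin r, ((Fintype.card F : ℝ) ^ n - (Fintype.card F : ℝ) ^ (i : ℕ)) :=
    Finset.prod_pos fun i _ => sub_pos.mpr (pow_lt_pow_right₀
      (by exact_mod_cast Fintype.one_lt_card (α := F)) (i.2.trans_le hrn))
  rw [← Nat.cast_le (α := ℝ), Nat.cast_mul, hN] at hfix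
  have hG : 0 < (Nat.card (GL (Fin n) F) : ℝ) := Nat.cast_pos.mpr Nat.card_pos
  rw [one_div, ← div_eq_inv_mul, div_le_div_iff₀ (by positivity) hNpos]
  exact (hfix.trans hframes).trans_eq (mul_comm _ _)
end

section
/- Let n, k, r be positive integers, let R be a subset of {1, …, n} of size r, and let w ∈ F_k be a nontrivial word of reduced length ℓ with ℓ < n/r. Choose x_1, …, x_k independently and uniformly at random from the symmetric group Sym(n). Then the probability that the permutation w(x_1, …, x_k) maps R onto R is at most ( ℓ²·r / (n − ℓ·r) )^r. -/
namespace SchreierGraph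

open Finset

variable {ι α : Type*}

/-- The labelled edge `(i, u, v)`, standing for `x i u = v`, that is traversed when the inverse of
the letter `s` takes `a` to `c`. -/
def edge (s : ι × Bool) (a c : α) : ι × α × α := if s.2 then (s.1, c, a) else (s.1, a, c)

/-- `Trav E L a b`: applying the inverses of the letters of `L` in order leads from `a` to `b`
along edges in `E`. -/
def Trav (E : Finset (ι × α × α)) : List (ι × Bool) → α → α → Prop
  | [], a, b => a = b
  | s :: L, a, b => ∃ c, edge s a c ∈ E ∧ Trav E L c b

lemma edge_flip (i : ι) (t : Bool) (a c : α) : edge (i, !t) c a = edge (i, t) a c := by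
  cases t <;> rfl

/-- A reduced pair of consecutive letters cannot traverse one edge twice, unless it is a loop. -/
lemma eq_of_edge_eq {s t : ι × Bool} {a c d : α} (hst : s.1 = t.1 → s.2 = t.2)
    (h : edge t c d = edge s a c) : a = c := by
  unfold edge at h
  obtain ⟨i, b⟩ := s
  obtain ⟨j, b'⟩ := t
  cases b <;> cases b' <;> simp_all

lemma edge_endpoints (s : ι × Bool) (a c : α) :
    ((edge s a c).2.1 = a ∧ (edge s a c).2.2 = c) ∨
      ((edge s a c).2.1 = c ∧ (edge s a c).2.2 = a) := by
  unfold edge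
  split_ifs <;> simp

lemma Trav.mono {E F : Finset (ι × α × α)} (h : E ⊆ F) :
    ∀ {L : List (ι × Bool)} {a b : α}, Trav E L a b → Trav F L a b
  | [], _, _, hab => hab
  | _ :: _, _, _, ⟨c, hc, hL⟩ => ⟨c, h hc, hL.mono h⟩

lemma trav_append {E : Finset (ι × α × α)} {L M : List (ι × Bool)} {a b : α} :
    Trav E (L ++ M) a b ↔ ∃ c, Trav E L a c ∧ Trav E M c b := by
  induction L generalizing a with
  | nil => simp [Trav]
  | cons s L ih =>
    simp only [List.cons_append, Trav, ih]
    grind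

lemma Trav.invRev {E : Finset (ι × α × α)} {L : List (ι × Bool)} {a b : α} (h : Trav E L a b) :
    Trav E (FreeGroup.invRev L) b a := by
  induction L generalizing a with
  | nil => exact h.symm
  | cons s L ih =>
    obtain ⟨c, hc, hL⟩ := h
    rw [FreeGroup.invRev_cons, trav_append]
    refine ⟨c, ih hL, a, ?_, rfl⟩
    rwa [edge_flip]

/-- Either a whole word can be traversed, or it gets stuck at some letter. -/
lemma trav_or_stuck (E : Finset (ι × α × α)) (L : List (ι × Bool)) (a : α) :
    (∃ b, Trav E L a b) ∨ ∃ L₁ s L₂ p, L = L₁ ++ s :: L₂ ∧ Trav E L₁ a p ∧ ∀ c, edge s p c ∉ E := by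
  induction L generalizing a with
  | nil => exact .inl ⟨a, rfl⟩
  | cons s L ih =>
    by_cases h : ∃ c, edge s a c ∈ E
    · obtain ⟨c, hc⟩ := h
      rcases ih c with ⟨b, hb⟩ | ⟨L₁, t, L₂, p, rfl, hp, ht⟩
      · exact .inl ⟨b, c, hc, hb⟩
      · exact .inr ⟨s :: L₁, t, L₂, p, rfl, ⟨c, hc, hp⟩, ht⟩
    · exact .inr ⟨[], s, L, a, rfl, rfl, not_exists.mp h⟩

section Pruning

variable [DecidableEq α]

/-- Edge ends at `v`. -/
def degree (E : Finset (ι × α × α)) (v : α) : ℕ :=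
  #{e ∈ E | e.2.1 = v} + #{e ∈ E | e.2.2 = v}

lemma sum_degree_le (E : Finset (ι × α × α)) (V : Finset α) : ∑ v ∈ V, degree E v ≤ 2 * #E := by
  unfold degree
  rw [sum_add_distrib, sum_card_fiberwise_eq_card_filter, sum_card_fiberwise_eq_card_filter]
  have h₁ := card_filter_le E (fun e => e.2.1 ∈ V)
  have h₂ := card_filter_le E (fun e => e.2.2 ∈ V)
  omega

lemma eq_of_degree_le_one {E : Finset (ι × α × α)} {v : α} (hv : degree E v ≤ 1)
    {e f : ι × α × α} (he : e ∈ E) (hf : f ∈ E) (hev : e.2.1 = v ∨ e.2.2 = v)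
    (hfv : f.2.1 = v ∨ f.2.2 = v) : e = f := by
  unfold degree at hv
  have h₁ : #{e ∈ E | e.2.1 = v} ≤ 1 := by omega
  have h₂ : #{e ∈ E | e.2.2 = v} ≤ 1 := by omega
  have key : ∀ e f : ι × α × α, e ∈ E → f ∈ E → e.2.1 = v → f.2.2 = v → False := by
    intro e f he hf h h'
    have : 0 < #{e ∈ E | e.2.1 = v} := card_pos.mpr ⟨e, by simp [he, h]⟩
    have : 0 < #{e ∈ E | e.2.2 = v} := card_pos.mpr ⟨f, by simp [hf, h']⟩
    omega
  rw [card_le_one] at h₁ h₂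
  rcases hev with h | h <;> rcases hfv with h' | h'
  · exact h₁ e (by simp [he, h]) f (by simp [hf, h'])
  · exact (key e f he hf h h').elim
  · exact (key f e hf he h' h).elim
  · exact h₂ e (by simp [he, h]) f (by simp [hf, h'])

/-- A reduced path between other vertices avoids a leaf. -/
lemma Trav.avoid_leaf {E : Finset (ι × α × α)} {v : α} (hv : degree E v ≤ 1)
    {L : List (ι × Bool)} (hL : FreeGroup.IsReduced L) {a b : α} (h : Trav E L a b)
    (ha : a ≠ v) (hb : b ≠ v) : Trav {e ∈ E | e.2.1 ≠ v ∧ e.2.2 ≠ v} L a b := by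
  induction L generalizing a with
  | nil => exact h
  | cons s L ih =>
    obtain ⟨c, hc, hcb⟩ := h
    by_cases hcv : c = v
    · subst hcv
      cases L with
      | nil => exact (hb hcb.symm).elim
      | cons t L =>
        obtain ⟨d, hd, -⟩ := hcb
        rw [FreeGroup.isReduced_cons_cons] at hL
        refine (ha (eq_of_edge_eq hL.1 (eq_of_degree_le_one hv hd hc ?_ ?_))).elim
        · have := edge_endpoints t c d
          tauto
        · have := edge_endpoints s a c
          tauto
    · refine ⟨c, ?_, ih (hL.infix ⟨[s], [], by simp⟩) hcb hcv⟩
      rw [mem_filter]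
      refine ⟨hc, ?_⟩
      rcases edge_endpoints s a c with ⟨h₁, h₂⟩ | ⟨h₁, h₂⟩ <;> rw [h₁, h₂] <;> tauto

/-- If every vertex lies on a nonempty reduced closed path, there are at least as many edges as
vertices. -/
lemma card_le_card_of_closed (E : Finset (ι × α × α)) (V : Finset α)
    (h : ∀ v ∈ V, ∃ L : List (ι × Bool), L ≠ [] ∧ FreeGroup.IsReduced L ∧ Trav E L v v) :
    #V ≤ #E := by
  induction V using Finset.strongInduction generalizing E with
  | H V ih =>
    by_cases hdeg : ∀ v ∈ V, 2 ≤ degree E v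
    · have h₁ := card_nsmul_le_sum V (degree E) 2 hdeg
      have h₂ := h₁.trans (sum_degree_le E V)
      rw [smul_eq_mul] at h₂
      omega
    · push Not at hdeg
      obtain ⟨v, hvV, hv⟩ := hdeg
      have hle := ih (V.erase v) (erase_ssubset hvV) {e ∈ E | e.2.1 ≠ v ∧ e.2.2 ≠ v} (by
        intro u hu
        rw [mem_erase] at hu
        obtain ⟨L, hne, hred, hL⟩ := h u hu.2
        exact ⟨L, hne, hred, hL.avoid_leaf (by omega) hred hu.1 hu.1⟩)
      rw [card_erase_of_mem hvV] at hle
      obtain ⟨L, hne, -, hL⟩ := h v hvV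
      cases L with
      | nil => exact (hne rfl).elim
      | cons s L =>
        obtain ⟨c, hc, -⟩ := hL
        have hlt : #{e ∈ E | e.2.1 ≠ v ∧ e.2.2 ≠ v} < #E := by
          refine card_lt_card (filter_ssubset.mpr ⟨_, hc, ?_⟩)
          have := edge_endpoints s v c
          tauto
        omega

end Pruning

section Group

/-- The permutation by which the inverse of the letter `s` acts. -/
def letterPerm (x : ι → Equiv.Perm α) (s : ι × Bool) : Equiv.Perm α :=
  cond s.2 (x s.1)⁻¹ (x s.1)

/-- The tuple `x` realizes all edges in `E`. -/
def Realizes (E : Finset (ι × α × α)) (x : ι → Equiv.Perm α) : Prop :=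
  ∀ e ∈ E, x e.1 e.2.1 = e.2.2

lemma apply_edge_iff (x : ι → Equiv.Perm α) (s : ι × Bool) (a c : α) :
    x (edge s a c).1 (edge s a c).2.1 = (edge s a c).2.2 ↔ letterPerm x s a = c := by
  obtain ⟨i, b⟩ := s
  cases b
  · simp [edge, letterPerm]
  · simpa [edge, letterPerm] using eq_comm.trans (Equiv.Perm.inv_eq_iff_eq (f := x i)).symm

lemma Realizes.letterPerm_eq {E : Finset (ι × α × α)} {x : ι → Equiv.Perm α} (hx : Realizes E x)
    {s : ι × Bool} {a c : α} (h : edge s a c ∈ E) : letterPerm x s a = c :=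
  (apply_edge_iff x s a c).mp (hx _ h)

lemma lift_mk_cons_inv_apply (x : ι → Equiv.Perm α) (s : ι × Bool) (L : List (ι × Bool)) (a : α) :
    (FreeGroup.lift x (FreeGroup.mk (s :: L)))⁻¹ a =
      (FreeGroup.lift x (FreeGroup.mk L))⁻¹ (letterPerm x s a) := by
  obtain ⟨i, b⟩ := s
  cases b <;> simp [FreeGroup.lift_mk, letterPerm]

lemma Trav.lift_inv_apply {E : Finset (ι × α × α)} {x : ι → Equiv.Perm α} (hx : Realizes E x)
    {L : List (ι × Bool)} {a b : α} (h : Trav E L a b) :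
    (FreeGroup.lift x (FreeGroup.mk L))⁻¹ a = b := by
  induction L generalizing a with
  | nil => simpa [FreeGroup.lift_mk] using show a = b from h
  | cons s L ih =>
    obtain ⟨c, hc, hL⟩ := h
    rw [lift_mk_cons_inv_apply, hx.letterPerm_eq hc, ih hL]

lemma Trav.of_step {E : Finset (ι × α × α)} {x : ι → Equiv.Perm α} (hx : Realizes E x)
    {L M : List (ι × Bool)} (hLM : FreeGroup.Red.Step L M) {a b : α} (h : Trav E L a b) :
    Trav E M a b := by
  obtain @⟨L₁, L₂, i, t⟩ := hLM
  rw [trav_append] at h ⊢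
  obtain ⟨c, hc, d, hd, e, he, hb⟩ := h
  refine ⟨c, hc, ?_⟩
  rw [edge_flip] at he
  have he' : edge (i, !t) d e ∈ E := by rwa [edge_flip]
  have hd' : edge (i, !t) d c ∈ E := by rwa [edge_flip]
  rwa [← (hx.letterPerm_eq hd').symm.trans (hx.letterPerm_eq he')] at hb

/-- Some word representing `g` leads from `a` to `b` along `E`. -/
def Walk (E : Finset (ι × α × α)) (g : FreeGroup ι) (a b : α) : Prop :=
  ∃ L, FreeGroup.mk L = g ∧ Trav E L a b

lemma Walk.mul {E : Finset (ι × α × α)} {g h : FreeGroup ι} {a b c : α} (hg : Walk E g a b)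
    (hh : Walk E h b c) : Walk E (g * h) a c := by
  obtain ⟨L, rfl, hL⟩ := hg
  obtain ⟨M, rfl, hM⟩ := hh
  exact ⟨L ++ M, by simp, trav_append.mpr ⟨b, hL, hM⟩⟩

lemma Walk.inv {E : Finset (ι × α × α)} {g : FreeGroup ι} {a b : α} (hg : Walk E g a b) :
    Walk E g⁻¹ b a := by
  obtain ⟨L, rfl, hL⟩ := hg
  exact ⟨_, FreeGroup.inv_mk.symm, hL.invRev⟩

lemma Walk.mono {E F : Finset (ι × α × α)} (h : E ⊆ F) {g : FreeGroup ι} {a b : α}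
    (hg : Walk E g a b) : Walk F g a b := by
  obtain ⟨L, hL, hab⟩ := hg
  exact ⟨L, hL, hab.mono h⟩

lemma Walk.trav_toWord [DecidableEq ι] {E : Finset (ι × α × α)} {x : ι → Equiv.Perm α}
    (hx : Realizes E x) {g : FreeGroup ι} {a b : α} (h : Walk E g a b) : Trav E g.toWord a b := by
  obtain ⟨L, rfl, hL⟩ := h
  have hred : FreeGroup.Red L (FreeGroup.mk L).toWord := by
    rw [FreeGroup.toWord_mk]
    exact FreeGroup.reduce.red
  generalize (FreeGroup.mk L).toWord = M at hred
  induction hred with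
  | refl => exact hL
  | tail _ hs ih => exact ih.of_step hx hs

lemma Walk.pow {E : Finset (ι × α × α)} {g : FreeGroup ι} {R : Finset α} {f : α → α}
    (hf : ∀ a ∈ R, f a ∈ R ∧ Walk E g a (f a)) (m : ℕ) {a : α} (ha : a ∈ R) :
    f^[m] a ∈ R ∧ Walk E (g ^ m) a (f^[m] a) := by
  induction m with
  | zero => exact ⟨ha, [], rfl, rfl⟩
  | succ m ih =>
    rw [Function.iterate_succ_apply', pow_succ]
    exact ⟨(hf _ ih.1).1, ih.2.mul (hf _ ih.1).2⟩

end Group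

section Modification

variable [DecidableEq ι]

lemma realizes_insert_edge [DecidableEq α] {E : Finset (ι × α × α)} {x : ι → Equiv.Perm α} {s : ι × Bool}
    {a c : α} : Realizes (insert (edge s a c) E) x ↔ letterPerm x s a = c ∧ Realizes E x := by
  rw [← apply_edge_iff]
  simp [Realizes]

/-- Compose the action of the letter `s` with a permutation. -/
def modify (s : ι × Bool) (p : Equiv.Perm α) (x : ι → Equiv.Perm α) : ι → Equiv.Perm α :=
  Function.update x s.1 (cond s.2 (x s.1 * p⁻¹) (p * x s.1))

lemma letterPerm_modify (s : ι × Bool) (p : Equiv.Perm α) (x : ι → Equiv.Perm α) :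
    letterPerm (modify s p x) s = p * letterPerm x s := by
  obtain ⟨i, b⟩ := s
  cases b <;> simp [letterPerm, modify]

lemma modify_injective (s : ι × Bool) (p : Equiv.Perm α) :
    Function.Injective (modify (ι := ι) s p) := by
  intro x y h
  obtain ⟨i, b⟩ := s
  funext j
  have hj := congrFun h j
  by_cases hji : j = i
  · subst hji
    cases b <;> simpa [modify] using hj
  · simpa [modify, Function.update_of_ne hji] using hj

lemma realizes_modify {E : Finset (ι × α × α)} {s : ι × Bool} {p : Equiv.Perm α}
    (hp : ∀ a c, edge s a c ∈ E → p c = c) {x : ι → Equiv.Perm α} (hx : Realizes E x) :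
    Realizes E (modify s p x) := by
  rintro ⟨j, u, v⟩ he
  have hxe : x j u = v := hx _ he
  obtain ⟨i, b⟩ := s
  by_cases hji : j = i
  · subst hji
    cases b
    · simpa [modify, hxe] using hp u v (by simpa [edge] using he)
    · have hu : p u = u := hp v u (by simpa [edge] using he)
      have hu' : p.symm u = u := by rw [Equiv.symm_apply_eq, hu]
      simp [modify, hu', hxe]
  · simpa [modify, Function.update_of_ne hji] using hxe

end Modification

section Counting

variable [Fintype ι] [DecidableEq ι] [Fintype α] [DecidableEq α]

open Classical in
/-- The number of tuples of permutations that realize `E` and satisfy `P`. -/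
noncomputable def count (P : (ι → Equiv.Perm α) → Prop) (E : Finset (ι × α × α)) : ℕ :=
  #{x : ι → Equiv.Perm α | Realizes E x ∧ P x}

lemma count_mono {P Q : (ι → Equiv.Perm α) → Prop} {E : Finset (ι × α × α)}
    (h : ∀ x, Realizes E x → P x → Q x) : count P E ≤ count Q E := by
  classical
  refine card_le_card fun x hx => ?_
  simp only [mem_filter, mem_univ, true_and] at hx ⊢
  exact ⟨hx.1, h x hx.1 hx.2⟩

lemma count_eq_zero {P : (ι → Equiv.Perm α) → Prop} {E : Finset (ι × α × α)}
    (h : ∀ x, Realizes E x → ¬ P x) : count P E = 0 := by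
  classical
  refine card_eq_zero.mpr (filter_eq_empty_iff.mpr fun x _ hx => h x hx.1 hx.2)

/-- Exposing the image of `a` under the letter `s`. -/
lemma sum_count_insert_edge (P : (ι → Equiv.Perm α) → Prop) (E : Finset (ι × α × α))
    (s : ι × Bool) (a : α) : ∑ c, count P (insert (edge s a c) E) = count P E := by
  classical
  unfold count
  rw [card_eq_sum_card_fiberwise (f := fun x => letterPerm x s a) (t := univ) (by simp)]
  refine sum_congr rfl fun c _ => congrArg card ?_
  ext x
  simp only [realizes_insert_edge, mem_filter, mem_univ, true_and]
  tauto

/-- An unexposed image takes any given value with conditional probability at most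
`1 / (card α - #E)`. -/
lemma count_insert_edge_le {E : Finset (ι × α × α)} {s : ι × Bool} {a : α}
    (hfree : ∀ c, edge s a c ∉ E) (c : α) :
    (Fintype.card α - #E) * count (fun _ => True) (insert (edge s a c) E) ≤
      count (fun _ => True) E := by
  classical
  set T : Finset α := E.image (fun e => if s.2 then e.2.1 else e.2.2)
  have hmem : ∀ u v, edge s u v ∈ E → v ∈ T := by
    intro u v h
    refine mem_image.mpr ⟨_, h, ?_⟩
    unfold edge
    split_ifs <;> rfl
  by_cases hc : ∃ u, edge s u c ∈ E
  · obtain ⟨u, hu⟩ := hc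
    rw [count_eq_zero (fun x hx _ => ?_)]
    · simp
    · rw [realizes_insert_edge] at hx
      have := hx.2.letterPerm_eq hu
      rw [← hx.1] at this
      exact hfree c ((letterPerm x s).injective this ▸ hu)
  · push Not at hc
    have hle : ∀ d ∈ Tᶜ, count (fun _ => True) (insert (edge s a c) E) ≤
        count (fun _ => True) (insert (edge s a d) E) := by
      intro d hd
      refine card_le_card_of_injOn (modify s (Equiv.swap c d)) ?_
        (modify_injective s _).injOn
      intro x hx
      simp only [coe_filter, mem_univ, true_and, and_true, Set.mem_ofPred_eq,
        realizes_insert_edge] at hx ⊢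
      refine ⟨by simp [letterPerm_modify, hx.1], realizes_modify ?_ hx.2⟩
      intro u v huv
      refine Equiv.swap_apply_of_ne_of_ne ?_ ?_
      · rintro rfl
        exact hc u huv
      · rintro rfl
        exact mem_compl.mp hd (hmem u v huv)
    calc (Fintype.card α - #E) * count (fun _ => True) (insert (edge s a c) E)
        ≤ #Tᶜ * count (fun _ => True) (insert (edge s a c) E) := by
          refine Nat.mul_le_mul_right _ ?_
          rw [card_compl]
          exact Nat.sub_le_sub_left card_image_le _
      _ ≤ ∑ d ∈ Tᶜ, count (fun _ => True) (insert (edge s a d) E) := by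
          simpa using card_nsmul_le_sum _ _ _ hle
      _ ≤ ∑ d, count (fun _ => True) (insert (edge s a d) E) :=
          sum_le_sum_of_subset (subset_univ _)
      _ = count (fun _ => True) E := sum_count_insert_edge _ _ _ _

end Counting

section Exposure

variable [DecidableEq α]

/-- The known points: those in `R` and the endpoints of the edges in `E`. -/
def verts (R : Finset α) (E : Finset (ι × α × α)) : Finset α :=
  R ∪ E.image (fun e => e.2.1) ∪ E.image (fun e => e.2.2)

lemma mem_verts_of_edge_mem {R : Finset α} {E : Finset (ι × α × α)} {s : ι × Bool} {a c : α}
    (h : edge s a c ∈ E) : a ∈ verts R E ∧ c ∈ verts R E := by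
  have h₁ : (edge s a c).2.1 ∈ verts R E := by
    simp only [verts, mem_union]
    exact .inl (.inr (mem_image_of_mem (fun e : ι × α × α => e.2.1) h))
  have h₂ : (edge s a c).2.2 ∈ verts R E := by
    simp only [verts, mem_union]
    exact .inr (mem_image_of_mem (fun e : ι × α × α => e.2.2) h)
  rcases edge_endpoints s a c with ⟨h₃, h₄⟩ | ⟨h₃, h₄⟩ <;> rw [h₃] at h₁ <;> rw [h₄] at h₂ <;> tauto

/-- The edges `E` are connected to `R` and were exposed from `R` with exactly `m` coincidences,
that is, with `m` new edges leading to known points. -/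
structure Exposed (R : Finset α) (E : Finset (ι × α × α)) (m : ℕ) : Prop where
  card_add : #E + #R = #(verts R E) + m
  connected : ∀ v ∈ verts R E, ∃ g, ∃ ρ ∈ R, Walk E g v ρ

lemma exposed_empty (R : Finset α) : Exposed R (∅ : Finset (ι × α × α)) 0 where
  card_add := by simp [verts]
  connected v hv := ⟨1, v, by simpa [verts] using hv, [], rfl, rfl⟩

variable [DecidableEq ι]

lemma verts_insert_edge {R : Finset α} {E : Finset (ι × α × α)} (s : ι × Bool) {a : α} (c : α)
    (ha : a ∈ verts R E) : verts R (insert (edge s a c) E) = insert c (verts R E) := by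
  have key : verts R (insert (edge s a c) E) = insert a (insert c (verts R E)) := by
    ext v
    simp only [verts, image_insert, mem_union, mem_insert]
    rcases edge_endpoints s a c with ⟨h₃, h₄⟩ | ⟨h₃, h₄⟩ <;> rw [h₃, h₄] <;> tauto
  rw [key, insert_eq_of_mem (mem_insert_of_mem ha)]

lemma Exposed.insert_known {R : Finset α} {E : Finset (ι × α × α)} {m : ℕ} (h : Exposed R E m)
    {s : ι × Bool} {a c : α} (hE : edge s a c ∉ E) (ha : a ∈ verts R E) (hc : c ∈ verts R E) :
    Exposed R (insert (edge s a c) E) (m + 1) where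
  card_add := by
    have := h.card_add
    rw [verts_insert_edge s c ha, insert_eq_of_mem hc, card_insert_of_notMem hE]
    omega
  connected v hv := by
    rw [verts_insert_edge s c ha, insert_eq_of_mem hc] at hv
    obtain ⟨g, ρ, hρ, hg⟩ := h.connected v hv
    exact ⟨g, ρ, hρ, hg.mono (subset_insert _ _)⟩

lemma Exposed.insert_new {R : Finset α} {E : Finset (ι × α × α)} {m : ℕ} (h : Exposed R E m)
    {s : ι × Bool} {a c : α} (ha : a ∈ verts R E) (hc : c ∉ verts R E) :
    Exposed R (insert (edge s a c) E) m where
  card_add := by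
    have := h.card_add
    rw [verts_insert_edge s c ha, card_insert_of_notMem hc,
      card_insert_of_notMem fun h => hc (mem_verts_of_edge_mem h).2]
    omega
  connected v hv := by
    rw [verts_insert_edge s c ha, mem_insert] at hv
    rcases hv with rfl | hv
    · obtain ⟨g, ρ, hρ, hg⟩ := h.connected a ha
      have hs : Walk (insert (edge s a v) E) (FreeGroup.mk [s]) a v :=
        ⟨[s], rfl, v, mem_insert_self _ _, rfl⟩
      exact ⟨_, ρ, hρ, hs.inv.mul (hg.mono (subset_insert _ _))⟩
    · obtain ⟨g, ρ, hρ, hg⟩ := h.connected v hv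
      exact ⟨g, ρ, hρ, hg.mono (subset_insert _ _)⟩

/-- Once the trajectories of all points of `R` are exposed and end in `R`, there have been at least
`#R` coincidences. -/
lemma Exposed.card_le [Finite α] {R : Finset α} {E : Finset (ι × α × α)} {m : ℕ}
    (h : Exposed R E m) {w : FreeGroup ι} (hw : w ≠ 1) {x : ι → Equiv.Perm α} (hx : Realizes E x)
    (hR : ∀ ρ ∈ R, (FreeGroup.lift x w)⁻¹ ρ ∈ R) (htrav : ∀ ρ ∈ R, ∃ b, Trav E w.toWord ρ b) :
    #R ≤ m := by
  have hcard := h.card_add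
  suffices #(verts R E) ≤ #E by omega
  refine card_le_card_of_closed E _ fun v hv => ?_
  obtain ⟨g, ρ, hρ, hg⟩ := h.connected v hv
  set f := (FreeGroup.lift x w)⁻¹ with hf
  have hwalk : ∀ a ∈ R, f a ∈ R ∧ Walk E w a (f a) := by
    intro a ha
    obtain ⟨b, hb⟩ := htrav a ha
    have hab := hb.lift_inv_apply hx
    rw [FreeGroup.mk_toWord] at hab
    exact ⟨hR a ha, w.toWord, FreeGroup.mk_toWord, by rwa [hf, hab]⟩
  have hpow := (Walk.pow hwalk (orderOf f) hρ).2
  rw [Equiv.Perm.iterate_eq_pow, pow_orderOf_eq_one, Equiv.Perm.one_apply] at hpow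
  refine ⟨_, ?_, FreeGroup.isReduced_toWord, ((hg.mul hpow).mul hg.inv).trav_toWord hx⟩
  rw [Ne, FreeGroup.toWord_eq_nil_iff, conj_eq_one_iff,
    pow_eq_one_iff_left (orderOf_pos f).ne']
  exact hw

end Exposure

section Probability

variable [Fintype ι] [DecidableEq ι] [Fintype α] [DecidableEq α]

/-- Follow a trajectory from a known point `p` along fresh edges until the next coincidence, which
must occur if the trajectory is to end in `R`. -/
lemma count_le_of_free {R : Finset α} {P : (ι → Equiv.Perm α) → Prop} {m K : ℕ} {D M Q : ℝ}
    (hD : 0 < D) (hQ : 0 ≤ Q) (hDK : D + K ≤ Fintype.card α) (hM : ((K - 1 + #R - m : ℕ) : ℝ) ≤ M)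
    (hnext : ∀ E : Finset (ι × α × α), Exposed R E (m + 1) → #E ≤ K →
      (count P E : ℝ) ≤ count (fun _ => True) E * Q)
    {L : List (ι × Bool)} (hL : FreeGroup.IsReduced L) {E : Finset (ι × α × α)}
    (hE : Exposed R E m) (hlen : #E + L.length ≤ K) {p : α} (hp : p ∈ verts R E)
    (hfree : ∀ s ∈ L.head?, ∀ c, edge s p c ∉ E) (hnil : L = [] → p ∉ R)
    (hend : ∀ x, Realizes E x → P x → (FreeGroup.lift x (FreeGroup.mk L))⁻¹ p ∈ R) :
    (count P E : ℝ) ≤ count (fun _ => True) E * (L.length * (M / D) * Q) := by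
  induction L generalizing E p with
  | nil =>
    rw [count_eq_zero fun x hx hPx => hnil rfl (by simpa [FreeGroup.lift_mk] using hend x hx hPx)]
    simp
  | cons s L ih =>
    have hfree' : ∀ c, edge s p c ∉ E := hfree s rfl
    rw [List.length_cons] at hlen
    have hM0 : 0 ≤ M := (Nat.cast_nonneg _).trans hM
    have hstep : ∀ c, (count (fun _ => True) (insert (edge s p c) E) : ℝ) ≤
        count (fun _ => True) E / D := by
      intro c
      rw [le_div_iff₀ hD, mul_comm]
      have hEn : (#E : ℝ) + 1 ≤ K := by exact_mod_cast (by omega : #E + 1 ≤ K)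
      have hEc : #E ≤ Fintype.card α := by
        have : (#E : ℝ) ≤ Fintype.card α := by linarith
        exact_mod_cast this
      have h := count_insert_edge_le hfree' c
      rify [hEc] at h
      refine le_trans (mul_le_mul_of_nonneg_right ?_ (Nat.cast_nonneg _)) h
      linarith
    have hknown : ∀ c ∈ verts R E, (count P (insert (edge s p c) E) : ℝ) ≤
        count (fun _ => True) E / D * Q := by
      intro c hc
      refine (hnext _ (hE.insert_known (hfree' c) hp hc) ?_).trans
        (mul_le_mul_of_nonneg_right (hstep c) hQ)
      rw [card_insert_of_notMem (hfree' c)]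
      omega
    have hnew : ∀ c ∈ (verts R E)ᶜ, (count P (insert (edge s p c) E) : ℝ) ≤
        count (fun _ => True) (insert (edge s p c) E) * (L.length * (M / D) * Q) := by
      intro c hc
      rw [mem_compl] at hc
      refine ih (p := c) (hL.infix ⟨[s], [], by simp⟩) (hE.insert_new hp hc) ?_ ?_ ?_ ?_ ?_
      · rw [card_insert_of_notMem (hfree' c)]
        omega
      · rw [verts_insert_edge s c hp]
        exact mem_insert_self _ _
      · intro t ht d hd
        rw [mem_insert] at hd
        rcases hd with hd | hd
        · cases L with
          | nil => simp at ht
          | cons t' L =>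
            obtain rfl : t' = t := by simpa using ht
            rw [FreeGroup.isReduced_cons_cons] at hL
            exact hc (eq_of_edge_eq hL.1 hd ▸ hp)
        · exact hc (mem_verts_of_edge_mem hd).1
      · intro _ hcR
        exact hc (by simp [verts, hcR])
      · intro x hx hPx
        rw [realizes_insert_edge] at hx
        have := hend x hx.2 hPx
        rwa [lift_mk_cons_inv_apply, hx.1] at this
    have hV : (#(verts R E) : ℝ) ≤ M := by
      refine le_trans ?_ hM
      have := hE.card_add
      exact_mod_cast (by omega : #(verts R E) ≤ K - 1 + #R - m)
    have hsum : ∀ P : (ι → Equiv.Perm α) → Prop, (count P E : ℝ) =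
        ∑ c ∈ verts R E, (count P (insert (edge s p c) E) : ℝ) +
          ∑ c ∈ (verts R E)ᶜ, (count P (insert (edge s p c) E) : ℝ) := by
      intro P
      rw [sum_add_sum_compl]
      exact_mod_cast (sum_count_insert_edge P E s p).symm
    have h₁ := sum_le_card_nsmul _ _ _ hknown
    have h₂ := sum_le_sum hnew
    rw [← sum_mul] at h₂
    have h₃ : ∑ c ∈ (verts R E)ᶜ, (count (fun _ => True) (insert (edge s p c) E) : ℝ) ≤
        count (fun _ => True) E := by
      rw [hsum (fun _ => True)]
      exact le_add_of_nonneg_left (sum_nonneg fun _ _ => Nat.cast_nonneg _)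
    rw [hsum P]
    calc _ ≤ M * (count (fun _ => True) E / D * Q) +
          count (fun _ => True) E * (L.length * (M / D) * Q) := by
          refine add_le_add (h₁.trans ?_) (h₂.trans ?_)
          · rw [nsmul_eq_mul]
            gcongr
          · gcongr
      _ = _ := by
          rw [List.length_cons]
          push_cast
          ring

/-- With `t` coincidences still to come, the conditional probability that `w⁻¹` maps `R` into `R`
is at most `q ^ t`, where `q` bounds the probability of one coincidence. -/
lemma count_le_pow {R : Finset α} {w : FreeGroup ι} (hw : w ≠ 1) {D : ℝ} (hD : 0 < D)
    (hDn : D + w.norm * #R ≤ Fintype.card α) (t m : ℕ) (htm : m + t = #R)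
    {E : Finset (ι × α × α)} (hE : Exposed R E m) (hcard : #E ≤ w.norm * m) :
    (count (fun x => ∀ ρ ∈ R, (FreeGroup.lift x w)⁻¹ ρ ∈ R) E : ℝ) ≤
      count (fun _ => True) E * (w.norm * ((w.norm * #R : ℝ) / D)) ^ t := by
  induction t generalizing m E with
  | zero =>
    rw [pow_zero, mul_one]
    exact_mod_cast count_mono fun _ _ _ => trivial
  | succ t ih =>
    by_cases hgood : ∃ x, Realizes E x ∧ ∀ ρ ∈ R, (FreeGroup.lift x w)⁻¹ ρ ∈ R
    swap
    · push Not at hgood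
      rw [count_eq_zero fun x hx hPx => ?_]
      · rw [Nat.cast_zero]
        positivity
      · obtain ⟨ρ, hρ, h⟩ := hgood x hx
        exact h (hPx ρ hρ)
    obtain ⟨x, hx, hPx⟩ := hgood
    by_cases htrav : ∀ ρ ∈ R, ∃ b, Trav E w.toWord ρ b
    · have := hE.card_le hw hx hPx htrav
      omega
    push Not at htrav
    obtain ⟨ρ, hρ, hstuck⟩ := htrav
    rcases trav_or_stuck E w.toWord ρ with ⟨b, hb⟩ | ⟨L₁, s, L₂, p, hword, hp, hs⟩
    · exact (hstuck b hb).elim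
    have hlen : (s :: L₂).length ≤ w.norm := by
      rw [FreeGroup.norm, hword, List.length_append]
      omega
    have hpos : 0 < w.norm := lt_of_lt_of_le (by simp) hlen
    have hmR : m + 1 ≤ #R := by omega
    have hK : w.norm * (m + 1) ≤ w.norm * #R := Nat.mul_le_mul_left _ hmR
    have hM : w.norm * (m + 1) - 1 + #R - m ≤ w.norm * #R := by
      obtain ⟨l, hl⟩ := Nat.exists_eq_add_of_lt hpos
      obtain ⟨u, hu⟩ := Nat.exists_eq_add_of_le hmR
      rw [hl, hu]
      have : (0 + l + 1) * (m + 1) - 1 = l * (m + 1) + m := by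
        rw [Nat.sub_eq_iff_eq_add (Nat.mul_pos (by omega) (by omega))]
        ring
      rw [this]
      have : (0 + l + 1) * (m + 1 + u) = l * (m + 1) + l * u + (m + 1 + u) := by ring
      omega
    have hpV : p ∈ verts R E := by
      rcases List.eq_nil_or_concat L₁ with rfl | ⟨L, b, rfl⟩
      · obtain rfl : ρ = p := hp
        simp [verts, hρ]
      · rw [List.concat_eq_append, trav_append] at hp
        obtain ⟨c, -, d, hd, rfl⟩ := hp
        exact (mem_verts_of_edge_mem hd).2
    have hred : FreeGroup.IsReduced (s :: L₂) :=
      FreeGroup.isReduced_toWord.infix ⟨L₁, [], by rw [hword, List.append_nil]⟩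
    have hend : ∀ x, Realizes E x → (∀ ρ ∈ R, (FreeGroup.lift x w)⁻¹ ρ ∈ R) →
        (FreeGroup.lift x (FreeGroup.mk (s :: L₂)))⁻¹ p ∈ R := by
      intro x hx hPx
      have h := hPx ρ hρ
      rwa [← FreeGroup.mk_toWord (x := w), hword, ← FreeGroup.mul_mk, _root_.map_mul, mul_inv_rev,
        Equiv.Perm.mul_apply, hp.lift_inv_apply hx] at h
    have key := count_le_of_free (P := fun x => ∀ ρ ∈ R, (FreeGroup.lift x w)⁻¹ ρ ∈ R)
      (K := w.norm * (m + 1)) (D := D) (M := w.norm * #R)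
      (Q := (w.norm * ((w.norm * #R : ℝ) / D)) ^ t) hD (by positivity)
      (le_trans (by gcongr; exact_mod_cast hK) hDn) (by exact_mod_cast hM)
      (fun E' hE' hcard' => ih (m + 1) (by omega) hE' hcard') hred hE
      (by rw [Nat.mul_succ]; exact Nat.add_le_add hcard hlen) hpV
      (by simpa using fun c => hs c) (by simp) hend
    refine key.trans ?_
    rw [pow_succ']
    have hlen' : ((s :: L₂).length : ℝ) ≤ w.norm := by exact_mod_cast hlen
    gcongr

end Probability

end SchreierGraph

/-- **The probability that a short word stabilizes a given set of points**
(Lemma A.3). Let `R ⊆ {1, …, n}` with `|R| = r` and let `w ∈ F_k` be a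
nontrivial word of reduced length `ℓ < n/r`. For uniformly random
`x_1, …, x_k ∈ Sym(n)`, the probability that `w(x_1, …, x_k)` maps `R` onto `R`
is at most `(ℓ²r/(n - ℓr))^r`. -/
theorem stmt17 (n k r : ℕ) (hn : 0 < n) (hk : 0 < k) (hr : 0 < r)
    (R : Finset (Fin n)) (hR : R.card = r)
    (w : FreeGroup (Fin k)) (hw : w ≠ 1)
    (hℓ : (w.norm : ℝ) < (n : ℝ) / r) :
    (Nat.card {x : Fin k → Equiv.Perm (Fin n) //
        R.image (⇑(FreeGroup.lift x w)) = R} : ℝ) /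
        (Nat.card (Equiv.Perm (Fin n)) : ℝ) ^ k ≤
      ((w.norm : ℝ) ^ 2 * r / ((n : ℝ) - (w.norm : ℝ) * r)) ^ r := by
  classical
  have hr' : (0 : ℝ) < r := by exact_mod_cast hr
  rw [lt_div_iff₀ hr'] at hℓ
  have key := SchreierGraph.count_le_pow (R := R) hw (D := n - w.norm * r) (by linarith)
    (by rw [hR, Fintype.card_fin]; linarith) r 0 (by omega)
    (SchreierGraph.exposed_empty R) (by simp)
  have htotal : (SchreierGraph.count (fun _ => True) (∅ : Finset (Fin k × Fin n × Fin n)) : ℝ) =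
      (Nat.card (Equiv.Perm (Fin n)) : ℝ) ^ k := by
    simp [SchreierGraph.count, SchreierGraph.Realizes, Nat.card_eq_fintype_card]
  have hsub : Nat.card {x : Fin k → Equiv.Perm (Fin n) // R.image (⇑(FreeGroup.lift x w)) = R} ≤
      SchreierGraph.count (fun x : Fin k → Equiv.Perm (Fin n) =>
        ∀ ρ ∈ R, (FreeGroup.lift x w)⁻¹ ρ ∈ R) ∅ := by
    rw [Nat.card_eq_fintype_card, Fintype.card_subtype]
    refine Finset.card_le_card fun x hx => ?_
    simp only [Finset.mem_filter, Finset.mem_univ, true_and] at hx ⊢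
    refine ⟨fun e he => (Finset.notMem_empty e he).elim, fun ρ hρ => ?_⟩
    rw [← hx, Finset.mem_image] at hρ
    obtain ⟨σ, hσ, rfl⟩ := hρ
    simpa using hσ
  have hpos : (0 : ℝ) < (Nat.card (Equiv.Perm (Fin n)) : ℝ) ^ k := by
    have : 0 < Nat.card (Equiv.Perm (Fin n)) := Nat.card_pos
    positivity
  rw [div_le_iff₀ hpos, mul_comm, ← htotal]
  refine (Nat.cast_le.mpr hsub).trans (key.trans (le_of_eq ?_))
  rw [hR]
  ring
end

section
/- There exists an absolute constant c > 0 with the following property. Let n, k be positive integers and f ≥ 0 a real number. Let w ∈ F_k be a nontrivial word of reduced length ℓ with ℓ < c·f^{1/2}. Choose x_1, …, x_k independently and uniformly at random from the symmetric group Sym(n). Then the probability that the permutation w(x_1, …, x_k) has at least f fixed points is at most exp( −c·f / ℓ² ). -/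
namespace WordWalk

open Finset

variable {V ι : Type*}

/-- The permutation attached to a letter: `(a, true)` is `x a`, and `(a, false)` its inverse. -/
def step (x : ι → Equiv.Perm V) (t : ι × Bool) : Equiv.Perm V :=
  cond t.2 (x t.1) (x t.1)⁻¹

/-- The trajectory of `v` when the letters `s 0, s 1, …` are applied successively. -/
def path (x : ι → Equiv.Perm V) (s : ℕ → ι × Bool) (v : V) : ℕ → V
  | 0 => v
  | i + 1 => step x (s i) (path x s v i)

lemma step_not (x : ι → Equiv.Perm V) (a : ι) (b : Bool) :
    step x (a, !b) = (step x (a, b))⁻¹ := by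
  cases b <;> simp [step]

lemma path_injective (x : ι → Equiv.Perm V) (s : ℕ → ι × Bool) (i : ℕ) :
    Function.Injective fun v => path x s v i := by
  induction i with
  | zero => exact fun _ _ h => h
  | succ i ih => exact fun _ _ h => ih ((step x (s i)).injective h)

lemma exists_first_return (x : ι → Equiv.Perm V) (s : ℕ → ι × Bool) (v : V) {l : ℕ} (hl : 0 < l)
    (h : path x s v l = v) :
    ∃ i j, i < l ∧ j ≤ i ∧ path x s v (i + 1) = path x s v j ∧
      ∀ a ≤ i, ∀ b ≤ i, path x s v a = path x s v b → a = b := by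
  classical
  have hex : ∃ i, ∃ j ≤ i, path x s v (i + 1) = path x s v j :=
    ⟨l - 1, 0, by omega, by rw [Nat.sub_add_cancel hl]; exact h⟩
  obtain ⟨j, hj, e⟩ := Nat.find_spec hex
  refine ⟨Nat.find hex, j, ?_, hj, e, ?_⟩
  · have := Nat.find_min' hex (m := l - 1)
      ⟨0, by omega, by rw [Nat.sub_add_cancel hl]; exact h⟩
    omega
  · have key : ∀ a b, a < b → b ≤ Nat.find hex → path x s v b ≠ path x s v a := by
      intro a b hab hb e
      obtain ⟨b, rfl⟩ : ∃ c, b = c + 1 := ⟨b - 1, by omega⟩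
      exact Nat.find_min hex (m := b) (by omega) ⟨a, by omega, e⟩
    intro a ha b hb e
    rcases lt_trichotomy a b with h | h | h
    · exact absurd e.symm (key a b h hb)
    · exact h
    · exact absurd e (key b a h ha)

lemma path_eq_prod (x : ι → Equiv.Perm V) (L : List (ι × Bool)) (d : ι × Bool) (v : V) :
    ∀ i ≤ L.length, path x (fun r => L.reverse.getD r d) v i =
      ((L.drop (L.length - i)).map (step x)).prod v := by
  intro i
  induction i with
  | zero => simp [path]
  | succ i ih =>
    intro hi
    rw [path, ih (by omega), List.drop_eq_getElem_cons (i := L.length - (i + 1)) (by omega),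
      List.map_cons, List.prod_cons, Equiv.Perm.mul_apply,
      show L.length - (i + 1) + 1 = L.length - i by omega]
    congr 2
    rw [List.getD_eq_getElem _ _ (by simpa using hi), List.getElem_reverse]
    congr 1
    omega

lemma lift_apply_eq_path [DecidableEq ι] (x : ι → Equiv.Perm V) (w : FreeGroup ι) (d : ι × Bool) (v : V) :
    FreeGroup.lift x w v = path x (fun r => w.toWord.reverse.getD r d) v w.norm := by
  rw [FreeGroup.norm, path_eq_prod x w.toWord d v _ le_rfl, Nat.sub_self, List.drop_zero]
  conv_lhs => rw [← FreeGroup.mk_toWord (x := w), FreeGroup.lift_mk]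
  rfl

lemma getD_reverse_toWord_ne [DecidableEq ι] (w : FreeGroup ι) (d : ι × Bool) (r : ℕ) (hr : r + 1 < w.norm) :
    w.toWord.reverse.getD r d ≠
      ((w.toWord.reverse.getD (r + 1) d).1, !(w.toWord.reverse.getD (r + 1) d).2) := by
  rw [FreeGroup.norm] at hr
  have h := FreeGroup.isReduced_toWord (x := w)
  rw [FreeGroup.IsReduced, List.isChain_iff_getElem] at h
  have h := h (w.toWord.length - 1 - (r + 1)) (by omega)
  rw [List.getD_eq_getElem _ _ (by simp; omega), List.getD_eq_getElem _ _ (by simp; omega),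
    List.getElem_reverse, List.getElem_reverse]
  simp only [show w.toWord.length - 1 - (r + 1) + 1 = w.toWord.length - 1 - r by omega] at h
  intro e
  have h' := h (by rw [e])
  rw [e] at h'
  simp at h'

open Classical in
lemma sum_fin_succ_card [Fintype V] {α : Type*} (S : Finset α) {m : ℕ} (P : α → (Fin (m + 1) → V) → Prop) :
    ∑ x ∈ S, #{g : Fin (m + 1) → V | P x g} =
      ∑ x ∈ S, ∑ g : Fin m → V, #{v | P x (Fin.cons v g)} := by
  refine sum_congr rfl fun x _ => ?_
  simp only [card_filter]
  rw [← (Fin.consEquiv fun _ => V).sum_comp, Fintype.sum_prod_type, sum_comm]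
  rfl

variable [DecidableEq V]

/-- The set of points visited by `v` up to time `l`. -/
def traj (x : ι → Equiv.Perm V) (s : ℕ → ι × Bool) (l : ℕ) (v : V) : Finset V :=
  (range (l + 1)).image (path x s v)

lemma path_mem_traj (x : ι → Equiv.Perm V) (s : ℕ → ι × Bool) (v : V) {l i : ℕ} (h : i ≤ l) :
    path x s v i ∈ traj x s l v :=
  mem_image_of_mem _ (mem_range.2 (by omega))

lemma card_traj_le (x : ι → Equiv.Perm V) (s : ℕ → ι × Bool) (l : ℕ) (v : V) :
    #(traj x s l v) ≤ l + 1 :=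
  card_image_le.trans (card_range _).le

/-- The set of points visited up to time `l` by the members of the family `g`. -/
def trajs (x : ι → Equiv.Perm V) (s : ℕ → ι × Bool) (l : ℕ) {m : ℕ} (g : Fin m → V) : Finset V :=
  univ.biUnion fun a => traj x s l (g a)

lemma card_trajs_le (x : ι → Equiv.Perm V) (s : ℕ → ι × Bool) (l : ℕ) {m : ℕ} (g : Fin m → V) :
    #(trajs x s l g) ≤ m * (l + 1) := by
  simpa [trajs] using card_biUnion_le_card_mul univ (fun a => traj x s l (g a)) (l + 1)
    fun a _ => card_traj_le x s l (g a)

/-- The members of `g` return to themselves at time `l`, and their trajectories are disjoint. -/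
def Good (x : ι → Equiv.Perm V) (s : ℕ → ι × Bool) (l : ℕ) {m : ℕ} (g : Fin m → V) : Prop :=
  (∀ a, path x s (g a) l = g a) ∧
    ∀ a b, a ≠ b → Disjoint (traj x s l (g a)) (traj x s l (g b))

lemma good_cons (x : ι → Equiv.Perm V) (s : ℕ → ι × Bool) (l : ℕ) {m : ℕ} (v : V)
    (g : Fin m → V) :
    Good x s l (Fin.cons v g : Fin (m + 1) → V) ↔
      Good x s l g ∧ path x s v l = v ∧ Disjoint (traj x s l v) (trajs x s l g) := by
  simp only [Good, trajs, Fin.forall_fin_succ, Fin.cons_zero, Fin.cons_succ, disjoint_biUnion_right,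
    mem_univ, true_imp_iff, ne_eq, not_true_eq_false, false_imp_iff, Fin.succ_inj, true_and,
    (Fin.succ_ne_zero _), (Fin.succ_ne_zero _).symm, not_false_eq_true]
  constructor
  · rintro ⟨⟨h1, h2⟩, h3, h4⟩
    exact ⟨⟨h2, fun a b => (h4 a).2 b⟩, h1, h3⟩
  · rintro ⟨⟨h2, h4⟩, h1, h3⟩
    exact ⟨⟨h1, h2⟩, h3, fun a => ⟨(h3 a).symm, h4 a⟩⟩

open Classical in
/-- A good family can be prolonged by all but few of the points returning at time `l`. -/
lemma card_fixed_le_card_good_cons [Fintype V] (x : ι → Equiv.Perm V) (s : ℕ → ι × Bool) (l : ℕ) {m : ℕ}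
    (g : Fin m → V) (hg : Good x s l g) :
    #{v | path x s v l = v} ≤
      #{v | Good x s l (Fin.cons v g : Fin (m + 1) → V)} + m * (l + 1) ^ 2 := by
  let E : Finset V := (range (l + 1)).biUnion fun i => {v | path x s v i ∈ trajs x s l g}
  have hE : #E ≤ m * (l + 1) ^ 2 := by
    refine (card_biUnion_le_card_mul _ _ (m * (l + 1)) fun i _ => ?_).trans
      (by rw [card_range]; exact le_of_eq (by ring))
    refine (card_le_card_of_injOn (fun v => path x s v i) ?_
      (path_injective x s i).injOn).trans (card_trajs_le x s l g)
    intro v hv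
    simpa using hv
  refine (card_le_card ?_).trans ((card_union_le _ E).trans (by gcongr))
  intro v hv
  simp only [mem_filter, mem_univ, true_and, mem_union, E, mem_biUnion, good_cons] at hv ⊢
  by_contra! hcon
  refine hcon.1 hg hv (disjoint_left.2 fun y hy hy' => ?_)
  obtain ⟨i, hi, rfl⟩ := mem_image.1 hy
  exact hcon.2 i hi hy'

open Classical in
/-- Lower bound for the number of good families. -/
lemma pow_le_card_good [Fintype V] (x : ι → Equiv.Perm V) (s : ℕ → ι × Bool) (l : ℕ) {f : ℝ} (hf : 0 ≤ f)
    (hx : f ≤ #{v | path x s v l = v}) (m : ℕ) (hm : 2 * (m * (l + 1 : ℝ) ^ 2) ≤ f) :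
    (f / 2) ^ m ≤ #{g : Fin m → V | Good x s l g} := by
  induction m with
  | zero =>
    have : ({g : Fin 0 → V | Good x s l g} : Finset _) = univ :=
      filter_true_of_mem fun g _ => ⟨fun a => a.elim0, fun a => a.elim0⟩
    rw [this]
    simp
  | succ m ih =>
    have hm' : 2 * (m * (l + 1 : ℝ) ^ 2) ≤ f := by
      refine le_trans ?_ hm
      push_cast
      gcongr
      linarith
    have hsum := sum_fin_succ_card {x} (V := V) (m := m) fun x g => Good x s l g
    rw [sum_singleton, sum_singleton] at hsum
    rw [hsum, pow_succ]
    push_cast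
    calc (f / 2) ^ m * (f / 2) ≤ #{g : Fin m → V | Good x s l g} * (f / 2) := by
          gcongr
          exact ih hm'
      _ ≤ ∑ g with Good x s l g,
            (#{v | Good x s l (Fin.cons v g : Fin (m + 1) → V)} : ℝ) := by
          rw [← nsmul_eq_mul]
          refine card_nsmul_le_sum _ _ _ fun g hg => ?_
          have h := card_fixed_le_card_good_cons x s l g (mem_filter.1 hg).2
          have h' : (#{v | path x s v l = v} : ℝ) ≤
              #{v | Good x s l (Fin.cons v g : Fin (m + 1) → V)} + m * (l + 1 : ℝ) ^ 2 := by
            exact_mod_cast h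
          linarith
      _ ≤ _ := sum_le_univ_sum_of_nonneg fun _ => Nat.cast_nonneg _

variable [DecidableEq ι]

/-- Modify `x` so that the letter `t` is followed by the transposition of `p` and `q`. -/
def switch (x : ι → Equiv.Perm V) (t : ι × Bool) (p q : V) : ι → Equiv.Perm V :=
  Function.update x t.1 (cond t.2 (Equiv.swap p q * x t.1) (x t.1 * Equiv.swap p q))

lemma step_switch_self (x : ι → Equiv.Perm V) (t : ι × Bool) (p q : V) :
    step (switch x t p q) t = Equiv.swap p q * step x t := by
  obtain ⟨a, b⟩ := t
  cases b <;> simp [step, switch]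

lemma switch_switch (x : ι → Equiv.Perm V) (t : ι × Bool) (p q : V) :
    switch (switch x t p q) t p q = x := by
  obtain ⟨a, b⟩ := t
  cases b <;> simp [switch, mul_assoc, ← mul_assoc (Equiv.swap p q) (Equiv.swap p q)]

/-- A step is not affected by a switch unless it traverses one of the two switched edges. -/
lemma step_switch_of_ne (x : ι → Equiv.Perm V) (t r : ι × Bool) (p q y : V)
    (h : r = t → step x r y ≠ p ∧ step x r y ≠ q)
    (h' : r = (t.1, !t.2) → y ≠ p ∧ y ≠ q) :
    step (switch x t p q) r y = step x r y := by
  obtain ⟨a, b⟩ := t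
  obtain ⟨a', b'⟩ := r
  by_cases ha : a' = a
  · subst ha
    by_cases hb : b' = b
    · subst hb
      rw [step_switch_self, Equiv.Perm.mul_apply]
      exact Equiv.swap_apply_of_ne_of_ne (h rfl).1 (h rfl).2
    · obtain rfl : b' = !b := by cases b <;> cases b' <;> simp_all
      obtain ⟨h1, h2⟩ := h' rfl
      rw [step_not, step_not, step_switch_self, mul_inv_rev, Equiv.Perm.mul_apply,
        Equiv.swap_inv, Equiv.swap_apply_of_ne_of_ne h1 h2]
  · simp [step, switch, Function.update_of_ne ha]

/-- A trajectory avoiding both switched points is not affected by the switch. -/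
lemma path_switch_of_avoid (x : ι → Equiv.Perm V) (s : ℕ → ι × Bool) (t : ι × Bool) (p q v : V)
    (l : ℕ) (h : ∀ i ≤ l, path x s v i ≠ p ∧ path x s v i ≠ q) :
    ∀ i ≤ l, path (switch x t p q) s v i = path x s v i := by
  intro i
  induction i with
  | zero => exact fun _ => rfl
  | succ i ih =>
    intro hi
    rw [path, ih (by omega)]
    exact step_switch_of_ne x t _ p q _ (fun _ => h (i + 1) hi) fun _ => h i (by omega)

/-- Switching the edge that closes the trajectory of `v` for the first time does not affect the
part of the trajectory before that edge. -/
lemma path_switch_of_first_return (x : ι → Equiv.Perm V) (s : ℕ → ι × Bool) (q v : V) (i : ℕ)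
    (hs : ∀ r < i, s r ≠ ((s (r + 1)).1, !(s (r + 1)).2))
    (hinj : ∀ a ≤ i, ∀ b ≤ i, path x s v a = path x s v b → a = b)
    (hq : ∀ a ≤ i, path x s v a ≠ q) :
    ∀ r ≤ i, path (switch x (s i) (path x s v (i + 1)) q) s v r = path x s v r := by
  intro r
  induction r with
  | zero => exact fun _ => rfl
  | succ r ih =>
    intro hr
    rw [path, ih (by omega)]
    refine step_switch_of_ne x _ _ _ q _ (fun h => ⟨fun e => ?_, hq (r + 1) hr⟩)
      fun h => ⟨fun e => ?_, hq r (by omega)⟩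
    · rw [h, path] at e
      have := hinj r (by omega) i le_rfl ((step x (s i)).injective e)
      omega
    · have e' : path x s v (r + 1) = path x s v i := by
        rw [path, h, step_not, e, path]
        simp
      have := hinj _ hr i le_rfl e'
      subst this
      exact hs r (by omega) h

lemma good_switch (x : ι → Equiv.Perm V) (s : ℕ → ι × Bool) (l : ℕ) {m : ℕ} (g : Fin m → V)
    (t : ι × Bool) {p q : V} (hp : p ∉ trajs x s l g) (hq : q ∉ trajs x s l g)
    (h : Good x s l g) : Good (switch x t p q) s l g := by
  have hpath : ∀ a, ∀ i ≤ l, path (switch x t p q) s (g a) i = path x s (g a) i := by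
    intro a
    apply path_switch_of_avoid
    intro i hi
    have hmem : path x s (g a) i ∈ trajs x s l g :=
      mem_biUnion.2 ⟨a, mem_univ _, path_mem_traj x s _ hi⟩
    exact ⟨fun e => hp (e ▸ hmem), fun e => hq (e ▸ hmem)⟩
  have htraj : ∀ a, traj (switch x t p q) s l (g a) = traj x s l (g a) := fun a =>
    image_congr fun i hi => hpath a i (by simpa [Nat.lt_succ_iff] using hi)
  refine ⟨fun a => by rw [hpath a l le_rfl, h.1], fun a b hab => ?_⟩
  rw [htraj, htraj]
  exact h.2 a b hab

variable [Fintype V] [Fintype ι]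

open Classical in
/-- Prolonging a good family by a further point costs a factor of order `l ^ 2 / card V`. -/
lemma card_good_cons_mul_le (s : ℕ → ι × Bool) {l : ℕ} (hl : 0 < l)
    (hs : ∀ r, r + 1 < l → s r ≠ ((s (r + 1)).1, !(s (r + 1)).2)) {m : ℕ} (v : V)
    (g : Fin m → V) :
    #{x : ι → Equiv.Perm V | Good x s l (Fin.cons v g : Fin (m + 1) → V)} *
        (Fintype.card V - (m + 1) * (l + 1)) ≤
      #{x : ι → Equiv.Perm V | Good x s l g} * (l + 1) ^ 2 := by
  set A : Finset (ι → Equiv.Perm V) := {x | Good x s l (Fin.cons v g : Fin (m + 1) → V)} with hA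
  have hex : ∀ x : ι → Equiv.Perm V, ∃ i j, x ∈ A →
      i < l ∧ j ≤ i ∧ path x s v (i + 1) = path x s v j ∧
        ∀ a ≤ i, ∀ b ≤ i, path x s v a = path x s v b → a = b := by
    intro x
    by_cases hx : x ∈ A
    · obtain ⟨i, j, h⟩ :=
        exists_first_return x s v hl ((good_cons x s l v g).1 (mem_filter.1 hx).2).2.1
      exact ⟨i, j, fun _ => h⟩
    · exact ⟨0, 0, fun h => absurd h hx⟩
  choose i j hij using hex
  let U : (ι → Equiv.Perm V) → Finset V := fun x => (traj x s l v ∪ trajs x s l g)ᶜ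
  let sw : (ι → Equiv.Perm V) → V → ι → Equiv.Perm V := fun x u =>
    switch x (s (i x)) (path x s v (i x + 1)) u
  have hU : ∀ x, Fintype.card V - (m + 1) * (l + 1) ≤ #(U x) := by
    intro x
    have h1 := card_union_le (traj x s l v) (trajs x s l g)
    have h2 := card_traj_le x s l v
    have h3 := card_trajs_le x s l g
    rw [card_compl]
    have : (m + 1) * (l + 1) = m * (l + 1) + (l + 1) := by ring
    omega
  have hmemU : ∀ x u, u ∈ U x → (∀ a ≤ l, path x s v a ≠ u) ∧ u ∉ trajs x s l g := by
    intro x u hu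
    simp only [U, mem_compl, mem_union, not_or] at hu
    exact ⟨fun a ha e => hu.1 (e ▸ path_mem_traj x s v ha), hu.2⟩
  have hpath : ∀ x ∈ A, ∀ u ∈ U x, ∀ r ≤ i x, path (sw x u) s v r = path x s v r := by
    intro x hx u hu
    obtain ⟨h1, -, -, h4⟩ := hij x hx
    exact path_switch_of_first_return x s u v (i x) (fun r hr => hs r (by omega)) h4
      fun a ha => (hmemU x u hu).1 a (by omega)
  have hend : ∀ x ∈ A, ∀ u ∈ U x, path (sw x u) s v (i x + 1) = u := by
    intro x hx u hu
    rw [path, hpath x hx u hu _ le_rfl, step_switch_self, Equiv.Perm.mul_apply, ← path,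
      Equiv.swap_apply_left]
  calc #A * (Fintype.card V - (m + 1) * (l + 1))
      ≤ ∑ x ∈ A, #(U x) := by
        rw [← smul_eq_mul]
        exact card_nsmul_le_sum _ _ _ fun x _ => hU x
    _ = #(A.sigma U) := (card_sigma _ _).symm
    _ ≤ #(({x : ι → Equiv.Perm V | Good x s l g} : Finset _) ×ˢ
          (range (l + 1) ×ˢ range (l + 1))) := by
        refine card_le_card_of_injOn (fun z => (sw z.1 z.2, i z.1, j z.1)) ?_ ?_
        · rintro ⟨x, u⟩ hz
          obtain ⟨hx, hu⟩ := mem_sigma.1 (mem_coe.1 hz)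
          obtain ⟨h1, h2, h3, -⟩ := hij x hx
          have hgood := (good_cons x s l v g).1 (mem_filter.1 hx).2
          simp only [coe_product, Set.mem_prod, mem_coe, mem_filter, mem_univ, true_and, mem_range]
          dsimp only at *
          refine ⟨good_switch x s l g _ ?_ (hmemU x u hu).2 hgood.1, by omega, by omega⟩
          exact disjoint_left.1 hgood.2.2 (path_mem_traj x s v (by omega))
        · rintro ⟨x, u⟩ hz ⟨y, u'⟩ hz' e
          obtain ⟨hx, hu⟩ := mem_sigma.1 (mem_coe.1 hz)
          obtain ⟨hy, hu'⟩ := mem_sigma.1 (mem_coe.1 hz')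
          simp only [Prod.mk.injEq] at e
          dsimp only at *
          obtain ⟨e1, e2, e3⟩ := e
          obtain ⟨-, hjx, hx3, -⟩ := hij x hx
          obtain ⟨-, hjy, hy3, -⟩ := hij y hy
          have eu : u = u' := by rw [← hend x hx u hu, ← hend y hy u' hu', e1, e2]
          have ep : path x s v (i x + 1) = path y s v (i y + 1) := by
            rw [hx3, hy3, ← hpath x hx u hu _ hjx, ← hpath y hy u' hu' _ hjy, e1, e3]
          have exy : x = y := by
            rw [← switch_switch x (s (i x)) (path x s v (i x + 1)) u,
              ← switch_switch y (s (i y)) (path y s v (i y + 1)) u', ← ep, ← eu, ← e2]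
            congr 1
            have := e1
            simp only [sw] at this
            rwa [← ep, ← eu, ← e2] at this
          subst exy eu
          rfl
    _ = #{x : ι → Equiv.Perm V | Good x s l g} * (l + 1) ^ 2 := by
        rw [card_product, card_product, card_range, sq]

open Classical in
/-- Upper bound for the expected number of good families. -/
lemma sum_card_good_le (s : ℕ → ι × Bool) {l : ℕ} (hl : 0 < l)
    (hs : ∀ r, r + 1 < l → s r ≠ ((s (r + 1)).1, !(s (r + 1)).2)) (hV : 0 < Fintype.card V)
    (m : ℕ) (hm : 2 * (m * (l + 1)) ≤ Fintype.card V) :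
    ∑ x : ι → Equiv.Perm V, #{g : Fin m → V | Good x s l g} ≤
      (2 * (l + 1) ^ 2) ^ m * Fintype.card (ι → Equiv.Perm V) := by
  induction m with
  | zero =>
    simp only [pow_zero, one_mul]
    refine (sum_le_card_nsmul _ _ 1 fun x _ => (card_le_univ _).trans (by simp)).trans (by simp)
  | succ m ih =>
    have ih := ih (le_trans (by gcongr; omega) hm)
    have key : ∀ (g : Fin m → V) (v : V),
        #{x : ι → Equiv.Perm V | Good x s l (Fin.cons v g : Fin (m + 1) → V)} *
          Fintype.card V ≤
        2 * (l + 1) ^ 2 * #{x : ι → Equiv.Perm V | Good x s l g} := by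
      intro g v
      have h := card_good_cons_mul_le s hl hs v g
      have h2 : Fintype.card V ≤ 2 * (Fintype.card V - (m + 1) * (l + 1)) := by omega
      calc _ ≤ #{x : ι → Equiv.Perm V | Good x s l (Fin.cons v g : Fin (m + 1) → V)} *
            (2 * (Fintype.card V - (m + 1) * (l + 1))) := by gcongr
        _ ≤ 2 * (#{x : ι → Equiv.Perm V | Good x s l g} * (l + 1) ^ 2) := by
          rw [mul_left_comm]; gcongr
        _ = _ := by ring
    have hswap : ∑ x : ι → Equiv.Perm V, #{g : Fin (m + 1) → V | Good x s l g} =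
        ∑ g : Fin m → V, ∑ v : V,
          #{x : ι → Equiv.Perm V | Good x s l (Fin.cons v g : Fin (m + 1) → V)} := by
      rw [sum_fin_succ_card]
      simp only [card_filter]
      rw [sum_comm]
      exact sum_congr rfl fun g _ => sum_comm
    have hswap' : ∑ x : ι → Equiv.Perm V, #{g : Fin m → V | Good x s l g} =
        ∑ g : Fin m → V, #{x : ι → Equiv.Perm V | Good x s l g} := by
      simp only [card_filter]
      exact sum_comm
    refine Nat.le_of_mul_le_mul_right ?_ hV
    calc (∑ x : ι → Equiv.Perm V, #{g : Fin (m + 1) → V | Good x s l g}) * Fintype.card V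
        ≤ ∑ g : Fin m → V, ∑ _v : V,
            2 * (l + 1) ^ 2 * #{x : ι → Equiv.Perm V | Good x s l g} := by
          rw [hswap, sum_mul]
          refine sum_le_sum fun g _ => ?_
          rw [sum_mul]
          exact sum_le_sum fun v _ => key g v
      _ = 2 * (l + 1) ^ 2 * (∑ x : ι → Equiv.Perm V, #{g : Fin m → V | Good x s l g}) *
            Fintype.card V := by
          simp only [sum_const, card_univ, smul_eq_mul]
          rw [← mul_sum, ← mul_sum, hswap']
          ring
      _ ≤ 2 * (l + 1) ^ 2 * ((2 * (l + 1) ^ 2) ^ m * Fintype.card (ι → Equiv.Perm V)) *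
            Fintype.card V := by gcongr
      _ = _ := by ring

open Classical in
/-- Markov's inequality for the number of good families of size `m`. -/
lemma card_many_fixed_mul_le (s : ℕ → ι × Bool) {l : ℕ} (hl : 0 < l)
    (hs : ∀ r, r + 1 < l → s r ≠ ((s (r + 1)).1, !(s (r + 1)).2)) (hV : 0 < Fintype.card V)
    {f : ℝ} (hf : 0 ≤ f) (hfV : f ≤ Fintype.card V) (m : ℕ)
    (hm : 2 * (m * (l + 1 : ℝ) ^ 2) ≤ f) :
    (#{x : ι → Equiv.Perm V | f ≤ #{v | path x s v l = v}} : ℝ) * (f / 2) ^ m ≤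
      (2 * (l + 1 : ℝ) ^ 2) ^ m * Fintype.card (ι → Equiv.Perm V) := by
  have hm' : 2 * (m * (l + 1)) ≤ Fintype.card V := by
    have h : (2 * (m * (l + 1)) : ℝ) ≤ Fintype.card V := by
      refine le_trans ?_ (hm.trans hfV)
      gcongr
      exact le_self_pow₀ (by linarith [(Nat.cast_nonneg l : (0 : ℝ) ≤ l)]) two_ne_zero
    exact_mod_cast h
  have h : ((∑ x : ι → Equiv.Perm V, #{g : Fin m → V | Good x s l g} : ℕ) : ℝ) ≤
      (2 * (l + 1 : ℝ) ^ 2) ^ m * Fintype.card (ι → Equiv.Perm V) := by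
    exact_mod_cast sum_card_good_le s hl hs hV m hm'
  refine le_trans ?_ h
  rw [← nsmul_eq_mul]
  push_cast
  refine le_trans (card_nsmul_le_sum _
    (fun x => (#{g : Fin m → V | Good x s l g} : ℝ)) _ fun x hx => ?_)
    (sum_le_univ_sum_of_nonneg fun _ => Nat.cast_nonneg _)
  exact pow_le_card_good x s l hf (mem_filter.1 hx).2 m hm

end WordWalk

/-- **Short words in random permutations have few fixed points with high
probability** (Theorem A.4). There is a constant `c > 0` such that for every
`f ≥ 0` and every nontrivial word `w ∈ F_k` of reduced length `ℓ < c·f^{1/2}`: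
for uniformly random `x_1, …, x_k ∈ Sym(n)`, the probability that
`w(x_1, …, x_k)` has at least `f` fixed points is at most `exp(-c·f/ℓ²)`. -/
theorem stmt18 :
    ∃ c : ℝ, 0 < c ∧
      ∀ (n k : ℕ), 0 < n → 0 < k →
        ∀ f : ℝ, 0 ≤ f →
          ∀ w : FreeGroup (Fin k), w ≠ 1 →
            (w.norm : ℝ) < c * Real.sqrt f →
            (Nat.card {x : Fin k → Equiv.Perm (Fin n) //
                f ≤ (Nat.card {v : Fin n // FreeGroup.lift x w v = v} : ℝ)} : ℝ) /
                (Nat.card (Equiv.Perm (Fin n)) : ℝ) ^ k ≤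
              Real.exp (-(c * f / (w.norm : ℝ) ^ 2)) := by
  refine ⟨1 / 16, by norm_num, ?_⟩
  intro n k hn hk f hf w hw hlen
  have hl : 0 < w.norm := Nat.pos_of_ne_zero fun h => hw (FreeGroup.norm_eq_zero.1 h)
  have hl1 : (1 : ℝ) ≤ w.norm := by exact_mod_cast hl
  have hlf : 256 * (w.norm : ℝ) ^ 2 ≤ f := by
    have h := pow_le_pow_left₀ (by positivity) hlen.le 2
    rw [mul_pow, Real.sq_sqrt hf] at h
    linarith
  rcases lt_or_ge (n : ℝ) f with hnf | hnf
  · have hempty : IsEmpty {x : Fin k → Equiv.Perm (Fin n) //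
        f ≤ (Nat.card {v : Fin n // FreeGroup.lift x w v = v} : ℝ)} := by
      refine ⟨fun x => ?_⟩
      have h1 := Nat.card_le_card_of_injective
        (Subtype.val : {v : Fin n // FreeGroup.lift x.1 w v = v} → Fin n)
        Subtype.val_injective
      rw [Nat.card_fin] at h1
      have h2 : (Nat.card {v : Fin n // FreeGroup.lift x.1 w v = v} : ℝ) ≤ n := by
        exact_mod_cast h1
      linarith [x.2]
    rw [Nat.card_of_isEmpty, Nat.cast_zero, zero_div]
    positivity
  set l := w.norm with hldef
  set s : ℕ → Fin k × Bool := fun r => w.toWord.reverse.getD r (⟨0, hk⟩, true) with hs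
  set m : ℕ := ⌊f / (8 * (l : ℝ) ^ 2)⌋₊ with hm
  have hl2 : (0 : ℝ) < (l : ℝ) ^ 2 := by positivity
  have hfpos : 0 < f := by linarith
  have hratio : 1 ≤ f / (8 * (l : ℝ) ^ 2) := by
    rw [le_div_iff₀ (by positivity)]
    linarith
  have hm_upper : 2 * (m * (l + 1 : ℝ) ^ 2) ≤ f := by
    have h1 : (m : ℝ) ≤ f / (8 * (l : ℝ) ^ 2) := Nat.floor_le (by positivity)
    rw [le_div_iff₀ (by positivity)] at h1
    have h2 : (l + 1 : ℝ) ^ 2 ≤ 4 * (l : ℝ) ^ 2 := by nlinarith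
    nlinarith [mul_le_mul_of_nonneg_left h2 (Nat.cast_nonneg m : (0 : ℝ) ≤ m)]
  have hm_lower : 1 / 16 * f / (l : ℝ) ^ 2 ≤ m := by
    have h1 : f / (8 * (l : ℝ) ^ 2) < m + 1 := Nat.lt_floor_add_one _
    have h2 : (1 : ℝ) ≤ m := Nat.one_le_cast.2 ((Nat.one_le_floor_iff _).2 hratio)
    have h3 : 1 / 16 * f / (l : ℝ) ^ 2 = f / (8 * (l : ℝ) ^ 2) / 2 := by
      field_simp
      norm_num
    rw [h3]
    linarith
  have key := WordWalk.card_many_fixed_mul_le (V := Fin n) s hl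
    (WordWalk.getD_reverse_toWord_ne w _) (by simpa using hn) hf (by simpa using hnf) m hm_upper
  have hcard : Nat.card {x : Fin k → Equiv.Perm (Fin n) //
      f ≤ (Nat.card {v : Fin n // FreeGroup.lift x w v = v} : ℝ)} =
      Finset.card {x : Fin k → Equiv.Perm (Fin n) |
        f ≤ Finset.card {v | WordWalk.path x s v l = v}} := by
    rw [Nat.card_eq_fintype_card, Fintype.card_subtype]
    congr 1
    ext x
    simp only [Finset.mem_filter, Finset.mem_univ, true_and, Nat.card_eq_fintype_card,
      Fintype.card_subtype, WordWalk.lift_apply_eq_path x w (⟨0, hk⟩, true), hs, hldef]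
  have htotal : (Fintype.card (Fin k → Equiv.Perm (Fin n)) : ℝ) =
      (Nat.card (Equiv.Perm (Fin n)) : ℝ) ^ k := by
    simp [Nat.card_eq_fintype_card]
  rw [← hcard, htotal] at key
  have hbase : 2 * (l + 1 : ℝ) ^ 2 ≤ f / 2 * Real.exp (-1) := by
    have h1 : (1 / 4 : ℝ) ≤ Real.exp (-1) := by
      rw [Real.exp_neg, one_div]
      exact inv_anti₀ (Real.exp_pos _) (by linarith [Real.exp_one_lt_d9])
    nlinarith
  rw [div_le_iff₀ (pow_pos (Nat.cast_pos.2 Nat.card_pos) k)]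
  refine le_of_mul_le_mul_right (key.trans ?_) (pow_pos (half_pos hfpos) m)
  calc (2 * (l + 1 : ℝ) ^ 2) ^ m * (Nat.card (Equiv.Perm (Fin n)) : ℝ) ^ k
      ≤ (f / 2 * Real.exp (-1)) ^ m * (Nat.card (Equiv.Perm (Fin n)) : ℝ) ^ k := by gcongr
    _ = Real.exp (-m) * (Nat.card (Equiv.Perm (Fin n)) : ℝ) ^ k * (f / 2) ^ m := by
        rw [mul_pow, ← Real.exp_nat_mul, mul_neg_one]
        ring
    _ ≤ _ := by gcongr
end
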